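/- arXiv:2312.15772 — 4 statements merged into one kernel-verified Lean document; each statement's English description precedes it below -/
import Mathlib

section
/- Let d ≥ 2, 1 ≤ m ≤ d−1, λ ∈ (0,1/2), γ ∈ ℝ, and let 𝔇 = m log 2 / log(1/λ). Write x = (x̄, x̂) ∈ ℝ^m × ℝ^{d−m}. There is a constant C = C(d,m,λ,γ) such that for all τ ∈ (0,4], all s ≥ 0, and all x with x̂ ≠ 0, the convolution of the measure μ^m_{λ,γ} × δ_0^{d−m} with the kernel 1_{{|ȳ| ≤ τ|ŷ|}} |y|^{−s} satisfies ∫_{ℝ^m} 1_{{|x̄−ȳ| ≤ τ|x̂|}} |(x̄−ȳ, x̂)|^{−s} dμ^m_{λ,γ}(ȳ) ≤ C · 1_{{dist(x̄, 𝔠^m_{λ,γ}) ≤ τ|x̂|}} · |x̂|^{𝔇−s} · (log(e + |x̂|^{−1}))^{−γ𝔇}. -/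
open MeasureTheory Real Set Metric Filter Topology NNReal ENNReal

noncomputable section

/-- `ℝ^n` with the Euclidean structure. -/
abbrev Euc (n : ℕ) := EuclideanSpace ℝ (Fin n)

/-- The open cube `(-1,1)^n`. -/
def Box (n : ℕ) : Set (Euc n) := {x | ∀ i, |x i| < 1}

/-- The last coordinate `x_d` of `x ∈ ℝ^{n+1}`. -/
def lastC {n : ℕ} (x : Euc (n + 1)) : ℝ := x (Fin.last n)

/-- The first `n` coordinates `x̄` of `x ∈ ℝ^{n+1}`. -/
def frontC {n : ℕ} (x : Euc (n + 1)) : Euc n := WithLp.toLp 2 fun i => x i.castSucc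

/-- Assemble a point of `ℝ^{n+1}` from `x̄ ∈ ℝ^n` and a last coordinate. -/
def snocC {n : ℕ} (xb : Euc n) (t : ℝ) : Euc (n + 1) :=
  WithLp.toLp 2 (Fin.snoc (α := fun _ => ℝ) xb.ofLp t)

/-- The first `m` coordinates of `x ∈ ℝ^{m+k}`. -/
def barPart {m k : ℕ} (x : Euc (m + k)) : Euc m := WithLp.toLp 2 fun i => x (Fin.castAdd k i)

/-- The last `k` coordinates of `x ∈ ℝ^{m+k}`. -/
def hatPart {m k : ℕ} (x : Euc (m + k)) : Euc k := WithLp.toLp 2 fun i => x (Fin.natAdd m i)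

/-- Admissibility of a sequence of interval lengths for the generalized `(λ,γ)`-Cantor set:
`l 0 = 1`, the lengths decrease fast enough (`l_{j-1} > 2 l_j`, removed gaps decreasing), and
`l j` is comparable to `λ^j j^γ`. -/
def IsCantorLengths (lam gam : ℝ) (l : ℕ → ℝ) : Prop :=
  l 0 = 1 ∧ (∀ j, 0 < l j) ∧ (∀ j, 2 * l (j + 1) < l j) ∧
    (∀ j, l (j + 1) - 2 * l (j + 2) < l j - 2 * l (j + 1)) ∧
    ∃ C : ℝ, 1 ≤ C ∧ ∀ j : ℕ, 1 ≤ j →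
      C⁻¹ * lam ^ j * (j : ℝ) ^ gam ≤ l j ∧ l j ≤ C * lam ^ j * (j : ℝ) ^ gam

/-- The point of the generalized Cantor set with address `ε` (left endpoints of the nested
intervals converge to this point). -/
def gCantorPoint (l : ℕ → ℝ) (ε : ℕ → Bool) : ℝ :=
  -(1 / 2 : ℝ) + ∑' j : ℕ, if ε j then l j - l (j + 1) else 0

/-- The generalized Cantor set determined by the lengths `l`. -/
def gCantorSet (l : ℕ → ℝ) : Set ℝ := Set.range (gCantorPoint l)

/-- The `m`-fold Cartesian power of the generalized Cantor set, inside `ℝ^m`. -/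
def gCantorSetPi (l : ℕ → ℝ) (m : ℕ) : Set (Euc m) := {x | ∀ i, x i ∈ gCantorSet l}

/-- The `j`-th binary digit of `t`. -/
def binDigit (t : ℝ) (j : ℕ) : Bool := ⌊t * 2 ^ (j + 1)⌋ % 2 = 1

/-- The Cantor measure attached to the lengths `l`: the image of the uniform distribution on
`[0,1)` under the map sending `t` to the Cantor point whose address is the binary digit
sequence of `t` (the digits being i.i.d. fair coins, this is the weak limit of the uniform
distributions on the pre-Cantor sets). -/
def gCantorMeasure (l : ℕ → ℝ) : Measure ℝ :=
  Measure.map (fun t => gCantorPoint l (binDigit t)) (volume.restrict (Set.Ico (0 : ℝ) 1))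

/-- The `m`-fold product of the Cantor measure, as a measure on `ℝ^m`. -/
def gCantorMeasurePi (l : ℕ → ℝ) (m : ℕ) : Measure (Euc m) :=
  Measure.map (⇑(MeasurableEquiv.toLp 2 (Fin m → ℝ)))
    (Measure.pi fun _ : Fin m => gCantorMeasure l)

/-- The fractal dimension `𝔇 = m log 2 / log(1/λ)`. -/
def frD (m : ℕ) (lam : ℝ) : ℝ := m * Real.log 2 / Real.log lam⁻¹

/-- `G` is the weak (distributional) differential of `u` on `Ω`:
integration by parts against smooth compactly supported test functions holds. -/
def HasWeakFDerivOn {n : ℕ} (Ω : Set (Euc n)) (u : Euc n → ℝ)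
    (G : Euc n → Euc n →L[ℝ] ℝ) : Prop :=
  ∀ φ : Euc n → ℝ, ContDiff ℝ (⊤ : ℕ∞) φ → HasCompactSupport φ → tsupport φ ⊆ Ω →
    ∫ x in Ω, u x • fderiv ℝ φ x = -∫ x in Ω, φ x • G x

/-- `u ∈ W^{1,1}(Ω)` with weak differential `G`. -/
def W11On {n : ℕ} (Ω : Set (Euc n)) (u : Euc n → ℝ) (G : Euc n → Euc n →L[ℝ] ℝ) : Prop :=
  IntegrableOn u Ω ∧ IntegrableOn G Ω ∧ HasWeakFDerivOn Ω u G

/-- `w ∈ W^{1,1}_0(Ω)` (with weak differential `G`): the extensions by zero form a Sobolev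
function on all of `ℝ^n`. -/
def ZeroBoundary {n : ℕ} (Ω : Set (Euc n)) (w : Euc n → ℝ)
    (G : Euc n → Euc n →L[ℝ] ℝ) : Prop :=
  Integrable (Set.indicator Ω w) ∧ Integrable (Set.indicator Ω G) ∧
    HasWeakFDerivOn Set.univ (Set.indicator Ω w) (Set.indicator Ω G)

/-- The energy `∫_Ω φ(x, g x) dx` for a scalar field `g` (typically `g = |∇w|`). -/
def energyOf {n : ℕ} (Ω : Set (Euc n)) (φ : Euc n → ℝ → ℝ) (g : Euc n → ℝ) : ℝ≥0∞ :=
  ∫⁻ x in Ω, ENNReal.ofReal (φ x (g x))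

/-- The Young (Legendre–Fenchel) conjugate `φ*(s) = sup_{t ≥ 0} (s t − φ(t))`. -/
def conjOrlicz (φ : ℝ → ℝ) (s : ℝ) : ℝ≥0∞ :=
  ⨆ t : ℝ≥0, ENNReal.ofReal (s * t - φ t)

/-- The conjugate energy `∫_Ω φ*(x, g x) dx`. -/
def energyConj {n : ℕ} (Ω : Set (Euc n)) (φ : Euc n → ℝ → ℝ) (g : Euc n → ℝ) : ℝ≥0∞ :=
  ∫⁻ x in Ω, conjOrlicz (φ x) (g x)

/-- `u` (with weak differential `G`, finite energy) is a local minimizer of the functional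
`w ↦ ∫_Ω φ(x,|∇w|) dx`: its energy does not exceed that of any Sobolev competitor that agrees
with `u` a.e. outside a compact subset of `Ω`. -/
def IsLocalMinimizer {n : ℕ} (Ω : Set (Euc n)) (φ : Euc n → ℝ → ℝ) (u : Euc n → ℝ)
    (G : Euc n → Euc n →L[ℝ] ℝ) : Prop :=
  W11On Ω u G ∧ energyOf Ω φ (fun x => ‖G x‖) < ⊤ ∧
    ∀ v Gv, W11On Ω v Gv →
      (∃ K : Set (Euc n), IsCompact K ∧ K ⊆ Ω ∧ ∀ᵐ x ∂(volume.restrict Ω), x ∉ K → v x = u x) →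
      energyOf Ω φ (fun x => ‖G x‖) ≤ energyOf Ω φ (fun x => ‖Gv x‖)

/-- `x` is a non-Lebesgue point of `u`: the averages of `|u − c|` on small balls around `x`
do not converge to `0` for any constant `c`. -/
def IsNonLebesguePoint {n : ℕ} (u : Euc n → ℝ) (x : Euc n) : Prop :=
  ¬ ∃ c : ℝ, Tendsto (fun r : ℝ => ⨍ y in Metric.ball x r, |u y - c| ∂volume)
      (𝓝[>] (0 : ℝ)) (𝓝 0)

/-- Membership in the Hölder class `C^α` on `s` (for `α ≥ 1` interpreted via
`C^{⌊α⌋, α − ⌊α⌋}`). -/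
def InHolderCls {n : ℕ} (α : ℝ) (s : Set (Euc n)) (a : Euc n → ℝ) : Prop :=
  ContDiffOn ℝ (⌊α⌋₊ : ℕ) a s ∧
    ∃ C : ℝ≥0, HolderOnWith C (Real.toNNReal (α - ⌊α⌋₊))
      (fun x => iteratedFDerivWithin ℝ ⌊α⌋₊ a s x) s

/-- The restricted Riesz potential `I₁^⋈(|f|)(x̄,0) = ∫_{C((x̄,0))} |f(y)| |x−y|^{1−d} dy`,
where `C(x)` is the double cone `{y : |ȳ − x̄| ≤ |y_d − x_d|/2}` (here `d = n+1`). -/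
def rieszBow {n : ℕ} (f : Euc (n + 1) → ℝ) (xb : Euc n) : ℝ≥0∞ :=
  ∫⁻ y : Euc (n + 1),
    ENNReal.ofReal ((if dist (frontC y) xb ≤ |lastC y| / 2 then (1 : ℝ) else 0) *
      |f y| * Real.sqrt (dist (frontC y) xb ^ 2 + lastC y ^ 2) ^ (-(n : ℝ)))

/-- The upper average `⟨f⟩⁺_{x̄,r} = ∫_{B_1} ω(y) f(x̄ + |r| ȳ, |r| y_d + |r|) dy`. -/
def avgPlus {n : ℕ} (ω : Euc (n + 1) → ℝ) (f : Euc (n + 1) → ℝ) (xb : Euc n) (r : ℝ) : ℝ :=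
  ∫ y in Metric.ball (0 : Euc (n + 1)) 1,
    ω y * f (snocC (xb + |r| • frontC y) (|r| * lastC y + |r|))

/-- The lower average `⟨f⟩⁻_{x̄,r} = ∫_{B_1} ω(y) f(x̄ + |r| ȳ, |r| y_d − |r|) dy`. -/
def avgMinus {n : ℕ} (ω : Euc (n + 1) → ℝ) (f : Euc (n + 1) → ℝ) (xb : Euc n) (r : ℝ) : ℝ :=
  ∫ y in Metric.ball (0 : Euc (n + 1)) 1,
    ω y * f (snocC (xb + |r| • frontC y) (|r| * lastC y - |r|))

open Classical in
/-- The function `u_d(x) = (1/2) sgn(x_d) θ(|x_d|/|x̄|)` (extended by its natural limit value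
`(1/2) sgn(x_d)` on the line `x̄ = 0`). -/
def uD {n : ℕ} (θ : ℝ → ℝ) (x : Euc (n + 1)) : ℝ :=
  if frontC x = 0 then (1 / 2) * Real.sign (lastC x)
  else (1 / 2) * Real.sign (lastC x) * θ (|lastC x| / ‖frontC x‖)

/-- Hypotheses on the profile function `θ`:
smooth on `(0,∞)`, `1_{(1/2,∞)} ≤ θ ≤ 1_{(1/4,∞)}` and `‖θ'‖_∞ ≤ 6`. -/
def IsProfile (θ : ℝ → ℝ) : Prop :=
  ContDiffOn ℝ (⊤ : ℕ∞) θ (Set.Ioi 0) ∧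
    (∀ t : ℝ, 0 < t → (if 1 / 2 < t then (1 : ℝ) else 0) ≤ θ t) ∧
    (∀ t : ℝ, 0 < t → θ t ≤ if 1 / 4 < t then 1 else 0) ∧
    (∀ t : ℝ, 0 < t → |deriv θ t| ≤ 6)

end
namespace CantorAux

theorem l_le {l : ℕ → ℝ} (h0 : l 0 = 1) (h2 : ∀ j, 2 * l (j + 1) < l j) (j : ℕ) :
    l j * 2 ^ j ≤ 1 := by
  induction j with
  | zero => simp [h0]
  | succ j ih =>
    have := h2 j
    have h3 : (0:ℝ) < 2 ^ j := by positivity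
    rw [pow_succ]
    nlinarith

/-- left endpoints -/
noncomputable def F (l : ℕ → ℝ) : ℕ → ℤ → ℝ
  | 0, n => -(1/2) + n
  | (j+1), n => F l j (n / 2) + if n % 2 = 1 then l j - l (j+1) else 0

theorem F_succ {l : ℕ → ℝ} (h0 : l 0 = 1) (h2 : ∀ j, 2 * l (j + 1) < l j) (j : ℕ) (n : ℤ) :
    F l j n + l j ≤ F l j (n + 1) := by
  induction j generalizing n with
  | zero => simp [F, h0]; linarith
  | succ j ih =>
    have := h2 j
    rcases Int.emod_two_eq_zero_or_one n with h | h
    · have e1 : (n + 1) / 2 = n / 2 := by omega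
      have e2 : (n + 1) % 2 = 1 := by omega
      simp only [F, e1, e2, h]
      norm_num
      linarith
    · have e1 : (n + 1) / 2 = n / 2 + 1 := by omega
      have e2 : (n + 1) % 2 = 0 := by omega
      have := ih (n / 2)
      simp only [F, e1, e2, h]
      norm_num
      linarith

theorem F_add {l : ℕ → ℝ} (h0 : l 0 = 1) (h2 : ∀ j, 2 * l (j + 1) < l j) (j : ℕ) (n : ℤ)
    (q : ℕ) : F l j n + q * l j ≤ F l j (n + q) := by
  induction q with
  | zero => simp
  | succ q ih =>
    have := F_succ h0 h2 j (n + q)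
    push_cast
    rw [← add_assoc]
    linarith

theorem floor_half (t : ℝ) (j : ℕ) : ⌊t * 2 ^ (j + 1)⌋ / 2 = ⌊t * 2 ^ j⌋ := by
  symm
  rw [Int.floor_eq_iff]
  have a := Int.floor_le (t * 2 ^ (j + 1))
  have b := Int.lt_floor_add_one (t * 2 ^ (j + 1))
  set N := ⌊t * 2 ^ (j + 1)⌋
  have c : 2 * (N / 2) ≤ N := by omega
  have c' : N + 1 ≤ 2 * (N / 2) + 2 := by omega
  have d : (2:ℝ) * ((N / 2 : ℤ) : ℝ) ≤ N := by exact_mod_cast c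
  have d' : (N : ℝ) + 1 ≤ 2 * ((N / 2 : ℤ) : ℝ) + 2 := by exact_mod_cast c'
  rw [pow_succ] at a b
  constructor <;> linarith

theorem partial_eq (l : ℕ → ℝ) {t : ℝ} (ht : t ∈ Set.Ico (0:ℝ) 1) (j : ℕ) :
    -(1/2) + ∑ i ∈ Finset.range j, (if binDigit t i then l i - l (i + 1) else 0)
      = F l j ⌊t * 2 ^ j⌋ := by
  induction j with
  | zero =>
    have : ⌊t⌋ = 0 := Int.floor_eq_zero_iff.mpr ht
    simp [F, this]
  | succ j ih =>
    rw [Finset.sum_range_succ, ← add_assoc, ih]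
    simp only [F, floor_half, binDigit, decide_eq_true_eq]

theorem partial_bd {l : ℕ → ℝ} (hp : ∀ j, 0 < l j) (h2 : ∀ j, 2 * l (j + 1) < l j)
    (ε : ℕ → Bool) (j q : ℕ) :
    ∑ i ∈ Finset.range (j + q), (if ε i then l i - l (i + 1) else 0) ≤
      ∑ i ∈ Finset.range j, (if ε i then l i - l (i + 1) else 0) + l j - l (j + q) := by
  induction q with
  | zero => simp
  | succ q ih =>
    rw [← add_assoc, Finset.sum_range_succ]
    have := h2 (j + q)
    have := hp (j + q + 1)
    have h3 : (if ε (j+q) then l (j+q) - l (j+q + 1) else 0) ≤ l (j+q) - l (j+q+1) := by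
      split_ifs <;> linarith
    linarith

theorem term_nonneg {l : ℕ → ℝ} (hp : ∀ j, 0 < l j) (h2 : ∀ j, 2 * l (j + 1) < l j)
    (ε : ℕ → Bool) (i : ℕ) : 0 ≤ (if ε i then l i - l (i + 1) else 0) := by
  have := h2 i
  have := hp (i + 1)
  split_ifs <;> linarith

theorem summ {l : ℕ → ℝ} (hp : ∀ j, 0 < l j) (h2 : ∀ j, 2 * l (j + 1) < l j)
    (ε : ℕ → Bool) : Summable fun i => (if ε i then l i - l (i + 1) else 0) := by
  refine summable_of_sum_range_le (c := l 0) (term_nonneg hp h2 ε) fun n => ?_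
  have := partial_bd hp h2 ε 0 n
  have := hp (0 + n)
  simp only [zero_add, Finset.range_zero, Finset.sum_empty] at *
  linarith

theorem point_bd {l : ℕ → ℝ} (hp : ∀ j, 0 < l j) (h2 : ∀ j, 2 * l (j + 1) < l j)
    {t : ℝ} (ht : t ∈ Set.Ico (0:ℝ) 1) (j : ℕ) :
    F l j ⌊t * 2 ^ j⌋ ≤ gCantorPoint l (binDigit t) ∧
    gCantorPoint l (binDigit t) ≤ F l j ⌊t * 2 ^ j⌋ + l j := by
  rw [← partial_eq l ht j, gCantorPoint]
  constructor
  · have := (summ hp h2 (binDigit t)).sum_le_tsum (Finset.range j)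
      (fun i _ => term_nonneg hp h2 _ i)
    linarith
  · have : ∑' i : ℕ, (if binDigit t i then l i - l (i + 1) else 0) ≤
        ∑ i ∈ Finset.range j, (if binDigit t i then l i - l (i + 1) else 0) + l j := by
      refine Real.tsum_le_of_sum_range_le (term_nonneg hp h2 _) fun n => ?_
      have h3 := partial_bd hp h2 (binDigit t) j n
      have h4 := hp (j + n)
      have h5 := Finset.sum_le_sum_of_subset_of_nonneg
        (Finset.range_mono (Nat.le_add_left n j))
        (fun i _ _ => term_nonneg hp h2 (binDigit t) i)
      linarith
    linarith

theorem sep {l : ℕ → ℝ} (h0 : l 0 = 1) (hp : ∀ j, 0 < l j) (h2 : ∀ j, 2 * l (j + 1) < l j)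
    {t t' : ℝ} (ht : t ∈ Set.Ico (0:ℝ) 1) (ht' : t' ∈ Set.Ico (0:ℝ) 1) (j : ℕ)
    (h : gCantorPoint l (binDigit t') - gCantorPoint l (binDigit t) ≤ l j) :
    t' - t ≤ 3 / 2 ^ j := by
  by_contra! hc
  have h3 : (0:ℝ) < 2 ^ j := by positivity
  rw [div_lt_iff₀ h3] at hc
  have a := Int.lt_floor_add_one (t' * 2 ^ j)
  have b := Int.floor_le (t * 2 ^ j)
  have hN : ⌊t * 2 ^ j⌋ + 2 < ⌊t' * 2 ^ j⌋ := by
    have : ((⌊t * 2 ^ j⌋ : ℤ) : ℝ) + 2 < (⌊t' * 2 ^ j⌋ : ℤ) := by linarith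
    exact_mod_cast this
  obtain ⟨q, hq⟩ := Int.le.dest hN.le
  have hq1 : 1 ≤ q := by omega
  have e := F_add h0 h2 j ⌊t * 2 ^ j⌋ (2 + q)
  have e2 : ⌊t * 2 ^ j⌋ + ((2 + q : ℕ) : ℤ) = ⌊t' * 2 ^ j⌋ := by push_cast; omega
  rw [e2] at e
  have p1 := (point_bd hp h2 ht j).2
  have p2 := (point_bd hp h2 ht' j).1
  have hq2 : (1:ℝ) ≤ q := by exact_mod_cast hq1
  push_cast at e
  have := hp j
  nlinarith

theorem meas {l : ℕ → ℝ} (hp : ∀ j, 0 < l j) (h2 : ∀ j, 2 * l (j + 1) < l j) :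
    Measurable fun t => gCantorPoint l (binDigit t) := by
  unfold gCantorPoint
  refine Measurable.const_add ?_ _
  refine measurable_of_tendsto_metrizable
    (f := fun n t => ∑ i ∈ Finset.range n, (if binDigit t i then l i - l (i + 1) else 0))
    (fun n => ?_) ?_
  · refine Finset.measurable_sum _ fun i _ => ?_
    refine Measurable.ite ?_ measurable_const measurable_const
    simp only [binDigit, decide_eq_true_eq]
    have : Measurable fun t : ℝ => ⌊t * 2 ^ (i + 1)⌋ := by fun_prop
    exact this (MeasurableSet.of_discrete (s := {n : ℤ | n % 2 = 1}))
  · rw [tendsto_pi_nhds]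
    intro t
    exact (summ hp h2 (binDigit t)).hasSum.tendsto_sum_nat

theorem cell {l : ℕ → ℝ} (h0 : l 0 = 1) (hp : ∀ j, 0 < l j) (h2 : ∀ j, 2 * l (j + 1) < l j)
    (j : ℕ) (x r : ℝ) (hj : j = 0 ∨ 8 * r ≤ l j) :
    (volume.restrict (Set.Ico (0 : ℝ) 1))
      {t | |x - gCantorPoint l (binDigit t)| ≤ 4 * r} ≤ ENNReal.ofReal (3 / 2 ^ j) := by
  rcases hj with rfl | hj
  · refine (measure_mono (Set.subset_univ _)).trans ?_
    simp
  · rw [Measure.restrict_apply' measurableSet_Ico]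
    refine (Real.volume_le_diam _).trans ?_
    refine ediam_le fun t ht t' ht' => ?_
    rw [edist_dist]
    apply ENNReal.ofReal_le_ofReal
    have a1 := abs_le.mp (show |x - gCantorPoint l (binDigit t)| ≤ 4 * r from ht.1)
    have a2 := abs_le.mp (show |x - gCantorPoint l (binDigit t')| ≤ 4 * r from ht'.1)
    rw [Real.dist_eq, abs_le]
    have s1 := sep h0 hp h2 ht.2 ht'.2 j (by linarith [a1.1, a1.2, a2.1, a2.2])
    have s2 := sep h0 hp h2 ht'.2 ht.2 j (by linarith [a1.1, a1.2, a2.1, a2.2])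
    constructor <;> linarith

theorem rpow_lower {B z g : ℝ} (hB : 1 ≤ B) (h1 : B⁻¹ ≤ z) (h2 : z ≤ B) :
    B ^ (-|g|) ≤ z ^ g := by
  have hB0 : 0 < B := by linarith
  have hz : 0 < z := lt_of_lt_of_le (by positivity) h1
  rcases le_total 0 g with h | h
  · rw [abs_of_nonneg h, Real.rpow_neg hB0.le, ← Real.inv_rpow hB0.le]
    exact Real.rpow_le_rpow (by positivity) h1 h
  · rw [abs_of_nonpos h, neg_neg]
    exact Real.rpow_le_rpow_of_nonpos hz h2 h

theorem scale {lam gam : ℝ} (hlam0 : 0 < lam) (hlam1 : lam < 1 / 2)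
    (l : ℕ → ℝ) (hl : IsCantorLengths lam gam l) :
    ∃ C : ℝ, 0 < C ∧ ∀ r : ℝ, 0 < r → ∃ j : ℕ, (j = 0 ∨ 8 * r ≤ l j) ∧
      lam ^ j ≤ C * (r * Real.log (Real.exp 1 + r⁻¹) ^ (-gam)) := by
  obtain ⟨h0, hp, h2, -, A, hA, hlb⟩ := hl
  have hA0 : 0 < A := by linarith
  set K : ℝ := Real.log lam⁻¹ + |gam| with hK
  have hK0 : 0 ≤ K := by
    have : 0 ≤ Real.log lam⁻¹ := Real.log_nonneg ((one_le_inv₀ hlam0).2 (by linarith))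
    positivity
  set E : ℝ := Real.exp 1 + 8 * A with hE
  have hE1 : 1 ≤ E := by
    have := Real.add_one_le_exp 1
    linarith
  set B : ℝ := Real.log E + K + 2 with hB
  have hlE : 0 ≤ Real.log E := Real.log_nonneg hE1
  have hB2 : 2 ≤ B := by linarith
  refine ⟨8 * A * lam⁻¹ * B ^ |gam|, by positivity, fun r hr => ?_⟩
  have hex : ∃ j, l (j + 1) < 8 * r := by
    obtain ⟨n, hn⟩ := exists_pow_lt_of_lt_one (show 0 < 8 * r by linarith)
      (show (1/2 : ℝ) < 1 by norm_num)
    refine ⟨n, lt_of_le_of_lt ?_ hn⟩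
    have := l_le h0 h2 n
    have h3 := h2 n
    have := hp (n + 1)
    rw [div_pow, one_pow, le_div_iff₀ (by positivity)]
    have : (0:ℝ) < 2 ^ n := by positivity
    nlinarith
  classical
  set j := Nat.find hex with hj
  have hj1 : l (j + 1) < 8 * r := Nat.find_spec hex
  have hj2 : j = 0 ∨ 8 * r ≤ l j := by
    rcases Nat.eq_zero_or_pos j with h | h
    · exact Or.inl h
    · right
      have := Nat.find_min hex (m := j - 1) (by omega)
      rw [Nat.sub_add_cancel h] at this
      linarith
  refine ⟨j, hj2, ?_⟩
  set L := Real.log (Real.exp 1 + r⁻¹) with hL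
  set n : ℝ := (j : ℝ) + 1 with hn
  have hn1 : 1 ≤ n := by rw [hn]; linarith [Nat.cast_nonneg (α := ℝ) j]
  have hn0 : 0 < n := by linarith
  have hlow : A⁻¹ * lam ^ (j + 1) * n ^ gam ≤ l (j + 1) := by
    have := (hlb (j + 1) (by omega)).1
    push_cast at this
    exact this
  have hr' : A⁻¹ * lam ^ (j + 1) * n ^ gam ≤ 8 * r := hlow.trans hj1.le
  have hngam : 0 < n ^ gam := Real.rpow_pos_of_pos hn0 _
  have hL1 : 1 ≤ L := by
    rw [hL, ← Real.log_exp 1]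
    apply Real.log_le_log (Real.exp_pos _)
    rw [Real.log_exp]
    have : 0 < r⁻¹ := by positivity
    linarith
  have hL0 : 0 < L := by linarith
  -- lower bound on L
  have hLlow : n / 2 ≤ L := by
    rcases hj2 with h | h
    · rw [hn, h]; simp; linarith
    · have h4 := l_le h0 h2 j
      have h5 : (2:ℝ) ^ (j + 1) ≤ Real.exp 1 + r⁻¹ := by
        have : (2:ℝ) ^ (j + 1) ≤ r⁻¹ := by
          rw [le_inv_comm₀ (by positivity) hr, ← one_div, le_div_iff₀ (by positivity), pow_succ]
          have : (0:ℝ) < 2 ^ j := by positivity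
          nlinarith
        linarith [Real.exp_pos 1]
      have h6 := Real.log_le_log (by positivity) h5
      rw [Real.log_pow] at h6
      push_cast at h6
      have := Real.log_two_gt_d9
      rw [← hn] at h6
      nlinarith
  -- upper bound
  have hLup : L ≤ B * n := by
    have h3 : r⁻¹ ≤ 8 * A * Real.exp (K * n) := by
      rw [inv_le_iff_one_le_mul₀ hr]
      have e1 : Real.exp (-(K * n)) ≤ lam ^ (j + 1) * n ^ gam := by
        have f1 : lam ^ (j + 1) = Real.exp (-(Real.log lam⁻¹ * n)) := by
          rw [Real.log_inv, neg_mul, neg_neg, Real.exp_mul, Real.exp_log hlam0, hn]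
          rw [← Nat.cast_add_one, Real.rpow_natCast]
        have f2 : Real.exp (-(|gam| * n)) ≤ n ^ gam := by
          rw [Real.rpow_def_of_pos hn0]
          apply Real.exp_le_exp.2
          have g1 : Real.log n ≤ n := (Real.log_le_sub_one_of_pos hn0).trans (by linarith)
          have g2 : 0 ≤ Real.log n := Real.log_nonneg hn1
          have g3 := neg_abs_le gam
          have g4 := abs_nonneg gam
          nlinarith
        rw [f1, hK, add_mul, neg_add, Real.exp_add]
        gcongr
      have e2 : lam ^ (j + 1) * n ^ gam ≤ A * (8 * r) := by
        rw [mul_assoc, inv_mul_le_iff₀ hA0] at hr'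
        exact hr'
      have e3 := e1.trans e2
      rw [Real.exp_neg, inv_le_iff_one_le_mul₀ (Real.exp_pos _)] at e3
      linarith
    have h4 : Real.exp 1 + r⁻¹ ≤ E * Real.exp (K * n) := by
      have : 1 ≤ Real.exp (K * n) := Real.one_le_exp (by positivity)
      have := Real.exp_pos 1
      rw [hE]; nlinarith
    have h5 := Real.log_le_log (by positivity) h4
    rw [Real.log_mul (by positivity) (by positivity), Real.log_exp] at h5
    rw [← hL] at h5
    rw [hB]
    nlinarith
  have hratio := rpow_lower (B := B) (z := n / L) (g := gam) (by linarith)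
    (by rw [le_div_iff₀ hL0, inv_mul_le_iff₀ (by linarith)]; exact hLup)
    (by rw [div_le_iff₀ hL0]; nlinarith)
  rw [Real.div_rpow hn0.le hL0.le, Real.rpow_neg (by linarith), div_eq_mul_inv,
    ← Real.rpow_neg hL0.le] at hratio
  set Z := L ^ (-gam) with hZ
  have hZ0 : 0 < Z := Real.rpow_pos_of_pos hL0 _
  have hBg : 0 < B ^ |gam| := Real.rpow_pos_of_pos (by linarith) _
  rw [inv_le_iff_one_le_mul₀ hBg] at hratio
  rw [mul_assoc, inv_mul_le_iff₀ hA0, pow_succ] at hr'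
  calc lam ^ j = lam⁻¹ * (lam ^ j * lam) := by field_simp
    _ ≤ lam⁻¹ * (lam ^ j * lam) * (n ^ gam * Z * B ^ |gam|) := by
        refine le_mul_of_one_le_right (by positivity) hratio
    _ = lam⁻¹ * Z * B ^ |gam| * (lam ^ j * lam * n ^ gam) := by ring
    _ ≤ lam⁻¹ * Z * B ^ |gam| * (A * (8 * r)) := by gcongr
    _ = _ := by ring

theorem lam_rpow {lam : ℝ} (hlam0 : 0 < lam) (hlam1 : lam < 1 / 2) (m j : ℕ) :
    (lam ^ j) ^ (frD m lam) = (1 / 2 ^ j) ^ m := by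
  have hne : Real.log lam ≠ 0 := Real.log_ne_zero_of_pos_of_ne_one hlam0 (by linarith)
  rw [Real.rpow_def_of_pos (by positivity), Real.log_pow, frD, Real.log_inv]
  have : (j : ℝ) * Real.log lam * (m * Real.log 2 / -Real.log lam) =
      ((m * j : ℕ) : ℝ) * Real.log (2⁻¹) := by
    rw [Real.log_inv]; push_cast; field_simp
  rw [this, Real.exp_nat_mul, Real.exp_log (by norm_num), one_div, ← inv_pow, ← pow_mul, mul_comm]

/-- parametrisation -/
noncomputable def G (l : ℕ → ℝ) (m : ℕ) (t : Fin m → ℝ) : Euc m :=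
  WithLp.toLp 2 fun i => gCantorPoint l (binDigit (t i))

theorem lint_le {l : ℕ → ℝ} (hp : ∀ j, 0 < l j) (h2 : ∀ j, 2 * l (j + 1) < l j) (m : ℕ)
    (f : Euc m → ℝ≥0∞) :
    ∫⁻ y, f y ∂(gCantorMeasurePi l m) ≤
      ∫⁻ t, f (G l m t) ∂(Measure.pi fun _ : Fin m => volume.restrict (Set.Ico (0 : ℝ) 1)) := by
  have hm := meas hp h2
  unfold gCantorMeasurePi gCantorMeasure
  refine (lintegral_map_le _ _).trans ?_
  have : IsFiniteMeasure (volume.restrict (Set.Ico (0 : ℝ) 1)) := inferInstance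
  rw [← Measure.pi_map_pi (fun _ => hm.aemeasurable)]
  refine (lintegral_map_le _ _).trans ?_
  exact le_rfl

end CantorAux

open CantorAux

/-- Estimate for the convolution of `μ^m_{λ,γ} × δ_0^{d−m}` with the
restricted Riesz kernel `1_{|ȳ| ≤ τ|ŷ|} |y|^{−s}`. -/
theorem cantor_convolution_estimate
    {d m k : ℕ} (hd : d = m + k) (hd2 : 2 ≤ d) (hm : 1 ≤ m) (hk : 1 ≤ k)
    {lam gam : ℝ} (hlam0 : 0 < lam) (hlam1 : lam < 1 / 2)
    (l : ℕ → ℝ) (hl : IsCantorLengths lam gam l) :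
    ∃ C : ℝ, 0 < C ∧ ∀ τ s : ℝ, 0 < τ → τ ≤ 4 → 0 ≤ s →
      ∀ (xb : Euc m) (xh : Euc k), xh ≠ 0 →
        (∫⁻ yb : Euc m, ENNReal.ofReal
            ((if dist xb yb ≤ τ * ‖xh‖ then (1 : ℝ) else 0) *
              Real.sqrt (dist xb yb ^ 2 + ‖xh‖ ^ 2) ^ (-s))
          ∂(gCantorMeasurePi l m)) ≤
        ENNReal.ofReal (C *
          (if Metric.infDist xb (gCantorSetPi l m) ≤ τ * ‖xh‖ then 1 else 0) *
          ‖xh‖ ^ (frD m lam - s) *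
          Real.log (Real.exp 1 + ‖xh‖⁻¹) ^ (-(gam * frD m lam))) := by
  obtain ⟨A, hA, hsc⟩ := scale hlam0 hlam1 l hl
  obtain ⟨h0, hp, h2, -, -⟩ := hl
  refine ⟨3 ^ m * A ^ frD m lam, by positivity, ?_⟩
  intro τ s hτ hτ4 hs xb xh hxh
  have hr : 0 < ‖xh‖ := norm_pos_iff.2 hxh
  set r := ‖xh‖ with hrdef
  refine (lint_le hp h2 m _).trans ?_
  by_cases hd : Metric.infDist xb (gCantorSetPi l m) ≤ τ * r
  swap
  · refine le_trans (le_of_eq ?_) (zero_le)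
    refine lintegral_eq_zero_of_ae_eq_zero (Filter.Eventually.of_forall ?_)

    intro t
    have hG : G l m t ∈ gCantorSetPi l m := fun i => ⟨_, rfl⟩
    have := Metric.infDist_le_dist_of_mem (x := xb) hG
    have hne : ¬ dist xb (G l m t) ≤ τ * r := fun h => hd (this.trans h)
    simp only [if_neg hne]
    simp
  obtain ⟨j, hj, hjl⟩ := hsc r hr
  rw [if_pos hd, mul_one]
  set L := Real.log (Real.exp 1 + r⁻¹) with hL
  have hL0 : 0 < L := by
    apply Real.log_pos
    have := Real.add_one_le_exp 1
    have : 0 < r⁻¹ := by positivity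
    linarith
  let S : Set (Fin m → ℝ) :=
    Set.pi Set.univ fun i => {t | |xb i - gCantorPoint l (binDigit t)| ≤ 4 * r}
  have hpt : ∀ t, ENNReal.ofReal ((if dist xb (G l m t) ≤ τ * r then (1 : ℝ) else 0) *
      Real.sqrt (dist xb (G l m t) ^ 2 + r ^ 2) ^ (-s)) ≤
      S.indicator (fun _ => ENNReal.ofReal (r ^ (-s))) t := by
    intro t
    split_ifs with h
    · have htS : t ∈ S := by
        intro i _
        have h1 : |xb i - G l m t i| ≤ dist xb (G l m t) := by
          rw [dist_eq_norm]
          exact PiLp.norm_apply_le (xb - G l m t) i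
        have h2 : τ * r ≤ 4 * r := by gcongr
        exact h1.trans (h.trans h2)
      rw [Set.indicator_of_mem htS, one_mul]
      apply ENNReal.ofReal_le_ofReal
      apply Real.rpow_le_rpow_of_nonpos hr _ (by linarith)
      apply Real.le_sqrt_of_sq_le
      nlinarith [sq_nonneg (dist xb (G l m t))]
    · simp
  refine (lintegral_mono hpt).trans ?_
  refine (lintegral_indicator_const_le _ _).trans ?_
  rw [Measure.pi_pi]
  have hprod : ∏ i : Fin m, (volume.restrict (Set.Ico (0 : ℝ) 1))
      {t | |xb i - gCantorPoint l (binDigit t)| ≤ 4 * r} ≤ ENNReal.ofReal ((3 / 2 ^ j) ^ m) := by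
    refine (Finset.prod_le_prod' fun i _ => cell h0 hp h2 j (xb i) r hj).trans ?_
    rw [Finset.prod_const, Finset.card_univ, Fintype.card_fin, ENNReal.ofReal_pow (by positivity)]
  refine (mul_le_mul_right hprod _).trans ?_
  rw [← ENNReal.ofReal_mul (by positivity)]
  apply ENNReal.ofReal_le_ofReal
  have hD : 0 ≤ frD m lam := by
    have : 0 ≤ Real.log lam⁻¹ := Real.log_nonneg ((one_le_inv₀ hlam0).2 (by linarith))
    unfold frD
    have := Real.log_nonneg (show (1:ℝ) ≤ 2 by norm_num)
    positivity
  have key := Real.rpow_le_rpow (by positivity) hjl hD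
  rw [lam_rpow hlam0 hlam1, Real.mul_rpow hA.le (by positivity),
    Real.mul_rpow hr.le (by positivity), ← Real.rpow_mul hL0.le, neg_mul] at key
  calc r ^ (-s) * (3 / 2 ^ j) ^ m = r ^ (-s) * 3 ^ m * (1 / 2 ^ j) ^ m := by
        rw [div_pow, div_pow, one_pow]; ring
    _ ≤ r ^ (-s) * 3 ^ m * (A ^ frD m lam * (r ^ frD m lam * L ^ (-(gam * frD m lam)))) := by
        gcongr
    _ = _ := by rw [sub_eq_add_neg, Real.rpow_add hr]; ring
end

section
/- Let d ≥ 2, 1 ≤ m ≤ d−1, λ ∈ (0,1/2), γ ∈ ℝ, 𝔇 = m log 2 / log(1/λ), and let Ω = (−1,1)^d. Write x = (x̄, x̂) ∈ ℝ^m × ℝ^{d−m}. For every β > 0 and δ ∈ ℝ there is a constant C such that for all t > 3, the Lebesgue measure of the superlevel set satisfies ℒ^d({ x ∈ Ω : |x̂|^{−β} (log(e + |x̂|^{−1}))^δ · 1_{{dist(x̄, 𝔠^m_{λ,γ}) ≤ 4|x̂|}} > t }) ≤ C · t^{(𝔇−d)/β} · (log t)^{γ𝔇 + (d−𝔇)δ/β}.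 -/
open MeasureTheory Real Set Metric Filter Topology NNReal ENNReal

/-- Left endpoint. -/
noncomputable def leftEnd (l : ℕ → ℝ) (s : Finset ℕ) : ℝ := -(1 / 2 : ℝ) + ∑ i ∈ s, (l i - l (i + 1))

/-- The neighbourhood of the Cantor set in one dimension. -/
noncomputable def nbhd (l : ℕ → ℝ) (j : ℕ) (r : ℝ) : Set ℝ :=
  ⋃ s ∈ (Finset.range j).powerset, Set.Icc (leftEnd l s - r) (leftEnd l s + l j + r)

theorem point_decomp (l : ℕ → ℝ) (hpos : ∀ j, 0 < l j) (hdec : ∀ j, 2 * l (j + 1) < l j)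
    (ε : ℕ → Bool) (j : ℕ) : ∃ s ∈ (Finset.range j).powerset,
      leftEnd l s ≤ gCantorPoint l ε ∧ gCantorPoint l ε ≤ leftEnd l s + l j := by
  set f : ℕ → ℝ := fun j => if ε j then l j - l (j + 1) else 0 with hf
  have hnn : ∀ i, 0 ≤ f i := by
    intro i
    simp only [hf]
    split_ifs
    · linarith [hpos (i + 1), hdec i]
    · exact le_rfl
  have hle : ∀ i, f i ≤ l i - l (i + 1) := by
    intro i
    simp only [hf]
    split_ifs
    · exact le_rfl
    · linarith [hpos (i + 1), hdec i]
  have hpart : ∀ a n, ∑ i ∈ Finset.range n, f (i + a) ≤ l a - l (n + a) := by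
    intro a n
    induction n with
    | zero => simp
    | succ n ih =>
      rw [Finset.sum_range_succ]
      have := hle (n + a)
      rw [show n + 1 + a = n + a + 1 by ring]
      linarith
  have hpart2 : ∀ a n, ∑ i ∈ Finset.range n, f (i + a) ≤ l a := fun a n => by
    linarith [hpart a n, hpos (n + a)]
  have hsum : Summable f :=
    summable_of_sum_range_le (c := l 0) hnn (fun n => by simpa using hpart2 0 n)
  have htail : ∑' i, f (i + j) ≤ l j :=
    Real.tsum_le_of_sum_range_le (fun n => hnn _) (hpart2 j)
  have htail0 : 0 ≤ ∑' i, f (i + j) := tsum_nonneg fun _ => hnn _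
  have hsplit := hsum.sum_add_tsum_nat_add j
  refine ⟨(Finset.range j).filter (fun i => ε i = true), by simp, ?_⟩
  have e1 : leftEnd l ((Finset.range j).filter (fun i => ε i = true))
      = -(1/2) + ∑ i ∈ Finset.range j, f i := by
    simp only [leftEnd, hf, Finset.sum_filter]
  have e2 : gCantorPoint l ε = -(1/2) + ∑' i, f i := rfl
  rw [e1, e2]
  constructor <;> linarith

theorem mem_nbhd (l : ℕ → ℝ) (hpos : ∀ j, 0 < l j) (hdec : ∀ j, 2 * l (j + 1) < l j)
    (j : ℕ) (r x y : ℝ) (hy : y ∈ gCantorSet l) (hxy : |x - y| ≤ r) : x ∈ nbhd l j r := by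
  obtain ⟨ε, rfl⟩ := hy
  obtain ⟨s, hs, h1, h2⟩ := point_decomp l hpos hdec ε j
  rw [abs_le] at hxy
  simp only [nbhd, Set.mem_iUnion]
  exact ⟨s, hs, by linarith, by linarith⟩

theorem volume_nbhd (l : ℕ → ℝ) (j : ℕ) (r : ℝ) :
    volume (nbhd l j r) ≤ ENNReal.ofReal (2 ^ j * (l j + 2 * r)) := by
  refine (measure_biUnion_finset_le _ _).trans ?_
  have : ∀ s : Finset ℕ, volume (Set.Icc (leftEnd l s - r) (leftEnd l s + l j + r))
      = ENNReal.ofReal (l j + 2 * r) := by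
    intro s
    rw [Real.volume_Icc]
    congr 1
    ring
  simp only [this]
  rw [Finset.sum_const, Finset.card_powerset, Finset.card_range, ENNReal.ofReal_mul (by positivity)]
  simp [ENNReal.ofReal_pow]

theorem volume_piSet {n : ℕ} (S : Fin n → Set ℝ) :
    volume {x : Euc n | ∀ i, x i ∈ S i} = ∏ i, volume (S i) := by
  rw [← MeasureTheory.volume_pi_pi]
  rw [← (EuclideanSpace.volume_preserving_symm_measurableEquiv_toLp (Fin n)).measure_preimage_equiv]
  congr 1
  ext x
  simp

theorem volume_Box_lt (n : ℕ) : volume (Box n) < ⊤ := by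
  have : Box n = {x : Euc n | ∀ i, x i ∈ Set.Ioo (-1 : ℝ) 1} := by
    ext x; simp [Box, abs_lt]
  rw [this, volume_piSet]
  simp

/-- Geometric covering estimate. -/
theorem geom_est {m k : ℕ} (l : ℕ → ℝ) (hpos : ∀ j, 0 < l j)
    (hdec : ∀ j, 2 * l (j + 1) < l j) (j : ℕ) (R : ℝ) (hR : 0 < R) :
    volume {x : Euc (m + k) | ‖hatPart x‖ ≤ R ∧
      Metric.infDist (barPart x) (gCantorSetPi l m) ≤ 4 * ‖hatPart x‖} ≤
    ENNReal.ofReal ((2 ^ j * (l j + 10 * R)) ^ m * (2 * R) ^ k) := by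
  have hsub : {x : Euc (m + k) | ‖hatPart x‖ ≤ R ∧
      Metric.infDist (barPart x) (gCantorSetPi l m) ≤ 4 * ‖hatPart x‖} ⊆
      {x : Euc (m + k) | ∀ i, x i ∈ (Fin.addCases (fun _ => nbhd l j (5 * R))
        (fun _ => Set.Icc (-R) R) i : Set ℝ)} := by
    rintro x ⟨h1, h2⟩ i
    have hne : (gCantorSetPi l m).Nonempty :=
      ⟨WithLp.toLp 2 fun _ => gCantorPoint l (fun _ => false), fun i => ⟨_, rfl⟩⟩
    have h3 : Metric.infDist (barPart x) (gCantorSetPi l m) < 5 * R := by linarith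
    obtain ⟨y, hy, hxy⟩ := (Metric.infDist_lt_iff hne).1 h3
    refine Fin.addCases (fun i => ?_) (fun i => ?_) i
    · rw [Fin.addCases_left]
      refine mem_nbhd l hpos hdec j _ _ (y i) (hy i) ?_
      have := PiLp.norm_apply_le (barPart x - y) i
      rw [← dist_eq_norm] at this
      exact (le_trans this hxy.le)
    · rw [Fin.addCases_right]
      have := PiLp.norm_apply_le (hatPart x) i
      exact abs_le.1 (this.trans h1)
  refine (measure_mono hsub).trans ?_
  rw [volume_piSet, Fin.prod_univ_add]
  simp only [Fin.addCases_left, Fin.addCases_right, Finset.prod_const, Finset.card_univ,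
    Fintype.card_fin, Real.volume_Icc]
  have hlj := hpos j
  rw [ENNReal.ofReal_mul (by positivity), ENNReal.ofReal_pow (by positivity),
    ENNReal.ofReal_pow (by positivity)]
  gcongr
  · convert volume_nbhd l j (5 * R) using 3
    ring
  · linarith

theorem one_lt_log_of_three_lt {t : ℝ} (ht : 3 < t) : 1 < Real.log t := by
  rw [Real.lt_log_iff_exp_lt (by linarith)]
  linarith [Real.exp_one_lt_d9]

theorem radius_est (β δ : ℝ) (hβ : 0 < β) :
    ∃ c : ℝ, 0 < c ∧ ∀ t : ℝ, 3 < t → ∀ r : ℝ, 0 ≤ r →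
      t < r ^ (-β) * Real.log (Real.exp 1 + r⁻¹) ^ δ →
      r ≤ c * (t ^ (-(1 / β)) * Real.log t ^ (δ / β)) := by
  have key : ∃ c : ℝ, 0 < c ∧ ∀ t : ℝ, 3 < t → ∀ r : ℝ, 0 < r →
      t < r ^ (-β) * Real.log (Real.exp 1 + r⁻¹) ^ δ →
      r ^ β ≤ t⁻¹ * (c * Real.log t) ^ δ := by
    have hmove : ∀ t r Q : ℝ, 0 < t → 0 < r → t < r ^ (-β) * Q → r ^ β ≤ t⁻¹ * Q := by
      intro t r Q ht hr h
      have hrb : 0 < r ^ β := Real.rpow_pos_of_pos hr β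
      rw [Real.rpow_neg hr.le] at h
      rw [inv_mul_eq_div, lt_div_iff₀ hrb] at h
      rw [inv_mul_eq_div, le_div_iff₀ ht]
      linarith
    rcases le_total 0 δ with hδ | hδ
    · refine ⟨2 + 1 / β, by positivity, fun t ht r hr h => ?_⟩
      have hL := one_lt_log_of_three_lt ht
      have ht0 : 0 < t := by linarith
      have hb : 0 < 1 / β := by positivity
      have hcL : 1 ≤ (2 + 1 / β) * Real.log t := by nlinarith
      rcases le_total (r ^ β) t⁻¹ with h1 | h1
      · refine h1.trans ?_
        have : 1 ≤ ((2 + 1 / β) * Real.log t) ^ δ := Real.one_le_rpow hcL hδ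
        have h2 : 0 < t⁻¹ := by positivity
        nlinarith
      · refine hmove t r _ ht0 hr (h.trans_le ?_)
        have hrinv : r⁻¹ ≤ t ^ (1 / β) := by
          have h3 : r⁻¹ ^ β ≤ t := by
            rw [Real.inv_rpow hr.le]
            exact inv_le_of_inv_le₀ ht0 h1
          calc r⁻¹ = (r⁻¹ ^ β) ^ (1 / β) := by
                rw [← Real.rpow_mul (by positivity), mul_one_div_cancel hβ.ne', Real.rpow_one]
            _ ≤ t ^ (1 / β) := Real.rpow_le_rpow (by positivity) h3 hb.le
        have hlog : Real.log (Real.exp 1 + r⁻¹) ≤ (2 + 1 / β) * Real.log t := by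
          have h4 : 1 ≤ t ^ (1 / β) := Real.one_le_rpow (by linarith) hb.le
          have h5 : Real.exp 1 + r⁻¹ ≤ Real.exp 2 * t ^ (1 / β) := by
            have e2 : Real.exp 2 = Real.exp 1 * Real.exp 1 := by
              rw [← Real.exp_add]; norm_num
            have e1 : 2 ≤ Real.exp 1 := by linarith [Real.exp_one_gt_d9]
            have e3 : Real.exp 1 + 1 ≤ Real.exp 2 := by rw [e2]; nlinarith
            nlinarith
          calc Real.log (Real.exp 1 + r⁻¹) ≤ Real.log (Real.exp 2 * t ^ (1 / β)) :=
                Real.log_le_log (by positivity) h5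
            _ = 2 + 1 / β * Real.log t := by
                rw [Real.log_mul (by positivity) (by positivity), Real.log_exp, Real.log_rpow ht0]
            _ ≤ _ := by nlinarith
        have hl0 : 0 ≤ Real.log (Real.exp 1 + r⁻¹) := by
          apply Real.log_nonneg
          have : 0 < r⁻¹ := by positivity
          linarith [Real.exp_one_gt_d9]
        gcongr
    · refine ⟨1 / β, by positivity, fun t ht r hr h => ?_⟩
      have hL := one_lt_log_of_three_lt ht
      have ht0 : 0 < t := by linarith
      have hb : 0 < 1 / β := by positivity
      have hri : 0 < r⁻¹ := by positivity
      have hl1 : 1 ≤ Real.log (Real.exp 1 + r⁻¹) := by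
        rw [Real.le_log_iff_exp_le (by positivity)]
        linarith
      refine hmove t r _ ht0 hr (h.trans_le ?_)
      have h1 : t < r⁻¹ ^ β := by
        refine h.trans_le ?_
        rw [Real.inv_rpow hr.le, ← Real.rpow_neg hr.le]
        have : Real.log (Real.exp 1 + r⁻¹) ^ δ ≤ 1 := Real.rpow_le_one_of_one_le_of_nonpos hl1 hδ
        have h2 : 0 < r ^ (-β) := Real.rpow_pos_of_pos hr _
        nlinarith
      have h2 : Real.log t ≤ β * Real.log (Real.exp 1 + r⁻¹) := by
        calc Real.log t ≤ Real.log (r⁻¹ ^ β) := Real.log_le_log ht0 h1.le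
          _ = β * Real.log r⁻¹ := Real.log_rpow hri β
          _ ≤ _ := by
            gcongr
            linarith [Real.exp_pos 1]
      have h3 : 1 / β * Real.log t ≤ Real.log (Real.exp 1 + r⁻¹) := by
        rw [one_div, inv_mul_eq_div, div_le_iff₀ hβ]; linarith
      have h4 := Real.rpow_le_rpow_of_nonpos (by positivity) h3 hδ
      gcongr
  obtain ⟨c, hc, H⟩ := key
  refine ⟨c ^ (δ / β), by positivity, fun t ht r hr h => ?_⟩
  have hL := one_lt_log_of_three_lt ht
  have hL0 : 0 < Real.log t := by linarith
  have ht0 : 0 < t := by linarith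
  rcases hr.eq_or_lt with h0 | h0
  · rw [← h0]; positivity
  · have h1 := H t ht r h0 h
    calc r = (r ^ β) ^ (1 / β) := by
          rw [← Real.rpow_mul h0.le, mul_one_div_cancel hβ.ne', Real.rpow_one]
      _ ≤ (t⁻¹ * (c * Real.log t) ^ δ) ^ (1 / β) :=
          Real.rpow_le_rpow (by positivity) h1 (by positivity)
      _ = _ := by
          rw [Real.mul_rpow (by positivity) (by positivity), ← Real.rpow_mul (by positivity),
            mul_one_div, Real.mul_rpow hc.le hL0.le, Real.inv_rpow ht0.le, ← Real.rpow_neg ht0.le]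
          ring

theorem rpow_between {c1 c2 L x g : ℝ} (h1 : 0 < c1) (h2 : 0 < c2) (hL : 0 < L)
    (hx1 : c1 * L ≤ x) (hx2 : x ≤ c2 * L) : x ^ g ≤ (c1 ^ g + c2 ^ g) * L ^ g := by
  have p1 : 0 < c1 ^ g := Real.rpow_pos_of_pos h1 g
  have p2 : 0 < c2 ^ g := Real.rpow_pos_of_pos h2 g
  have p3 : 0 < L ^ g := Real.rpow_pos_of_pos hL g
  rcases le_total 0 g with hg | hg
  · have := Real.rpow_le_rpow (by nlinarith [mul_pos h1 hL]) hx2 hg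
    rw [Real.mul_rpow h2.le hL.le] at this
    nlinarith
  · have := Real.rpow_le_rpow_of_nonpos (by positivity) hx1 hg
    rw [Real.mul_rpow h1.le hL.le] at this
    nlinarith

theorem choose_level {lam gam : ℝ} (m : ℕ) (hlam0 : 0 < lam) (hlam1 : lam < 1 / 2)
    (l : ℕ → ℝ) (hl : IsCantorLengths lam gam l) (β δ : ℝ) (hβ : 0 < β) :
    ∃ K T : ℝ, 0 < K ∧ ∀ t : ℝ, 3 < t → T ≤ t → ∃ j : ℕ,
      l j ≤ K * (t ^ (-(1 / β)) * Real.log t ^ (δ / β)) ∧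
      (2 : ℝ) ^ (j * m) ≤ (t ^ (-(1 / β)) * Real.log t ^ (δ / β - gam)) ^ (-frD m lam) := by
  obtain ⟨-, hpos, -, -, C, hC, hl⟩ := hl
  set b := 1 / β with hb
  set a := δ / β - gam with ha
  have hb0 : 0 < b := by positivity
  set Λ := Real.log lam⁻¹ with hΛ
  have hΛ0 : 0 < Λ := Real.log_pos (by
    rw [one_lt_inv₀ hlam0]; linarith)
  have ev1 : ∀ᶠ t in atTop, |a| * |Real.log (Real.log t)| ≤ b / 2 * Real.log t := by
    have h := (Real.isLittleO_log_id_atTop.comp_tendsto Real.tendsto_log_atTop).def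
      (c := b / 2 / (|a| + 1)) (by positivity)
    filter_upwards [h, Real.tendsto_log_atTop.eventually_gt_atTop 0] with t ht ht0
    simp only [Function.comp, id, Real.norm_eq_abs, abs_of_pos ht0] at ht
    have : (|a| + 1) * |Real.log (Real.log t)| ≤ b / 2 * Real.log t := by
      rw [div_mul_eq_mul_div, le_div_iff₀ (by positivity)] at ht
      linarith
    linarith [abs_nonneg (Real.log (Real.log t))]
  have ev2 : ∀ᶠ t in atTop, 2 ≤ b / (2 * Λ) * Real.log t :=
    (Real.tendsto_log_atTop.const_mul_atTop (by positivity)).eventually_ge_atTop 2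
  obtain ⟨T, hT⟩ := eventually_atTop.1 (ev1.and ev2)
  have hc1 : 0 < b / (4 * Λ) := by positivity
  have hc2 : 0 < 3 * b / (2 * Λ) := by positivity
  refine ⟨C * lam⁻¹ * ((b / (4 * Λ)) ^ gam + (3 * b / (2 * Λ)) ^ gam), T, by positivity,
    fun t ht3 htT => ?_⟩
  obtain ⟨h1, h2⟩ := hT t htT
  have hL := one_lt_log_of_three_lt ht3
  set L := Real.log t with hLdef
  have hL0 : 0 < L := by linarith
  have ht0 : 0 < t := by linarith
  rw [← abs_mul, abs_le] at h1
  set X := (b * L - a * Real.log L) / Λ with hX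
  have hXΛ : Λ * X = b * L - a * Real.log L := by rw [hX]; field_simp
  have hX1 : b / (2 * Λ) * L ≤ X := by
    rw [hX, le_div_iff₀ hΛ0]
    have : b / (2 * Λ) * L * Λ = b / 2 * L := by field_simp
    linarith
  have hX2 : X ≤ 3 * b / (2 * Λ) * L := by
    rw [hX, div_le_iff₀ hΛ0]
    have : 3 * b / (2 * Λ) * L * Λ = 3 * b / 2 * L := by field_simp
    linarith
  have hX0 : 2 ≤ X := by linarith
  have hj1 : (⌊X⌋₊ : ℝ) ≤ X := Nat.floor_le (by linarith)
  have hj2 : X < ⌊X⌋₊ + 1 := Nat.lt_floor_add_one X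
  set j := ⌊X⌋₊ with hj
  have hjone : 1 ≤ j := by
    have : (0 : ℝ) < j := by linarith
    exact_mod_cast this
  have hlamexp : lam = Real.exp (-Λ) := by
    rw [hΛ, Real.log_inv, neg_neg, Real.exp_log hlam0]
  have hρ : t ^ (-b) * L ^ a = Real.exp (-(Λ * X)) := by
    rw [Real.rpow_def_of_pos ht0, Real.rpow_def_of_pos hL0, ← Real.exp_add, hXΛ]
    congr 1
    ring
  have hlj : lam ^ j ≤ lam⁻¹ * (t ^ (-b) * L ^ a) := by
    rw [hρ, hlamexp, ← Real.exp_nat_mul, ← Real.exp_neg, ← Real.exp_add]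
    apply Real.exp_le_exp.2
    nlinarith
  refine ⟨j, ?_, ?_⟩
  · have hjg := rpow_between (g := gam) hc1 hc2 hL0 (x := j)
      (by
        have : b / (2 * Λ) * L = 2 * (b / (4 * Λ) * L) := by field_simp; ring
        linarith) (by linarith)
    calc l j ≤ C * lam ^ j * (j : ℝ) ^ gam := (hl j hjone).2
      _ ≤ C * (lam⁻¹ * (t ^ (-b) * L ^ a)) *
          (((b / (4 * Λ)) ^ gam + (3 * b / (2 * Λ)) ^ gam) * L ^ gam) := by
          gcongr
      _ = C * lam⁻¹ * ((b / (4 * Λ)) ^ gam + (3 * b / (2 * Λ)) ^ gam) *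
          (t ^ (-b) * (L ^ a * L ^ gam)) := by ring
      _ = _ := by
          rw [← Real.rpow_add hL0, ha, sub_add_cancel]
  · rw [hρ, ← Real.exp_mul]
    have h2e : (2 : ℝ) ^ (j * m) = Real.exp ((j * m : ℕ) * Real.log 2) := by
      rw [Real.exp_nat_mul, Real.exp_log (by norm_num)]
    rw [h2e]
    apply Real.exp_le_exp.2
    have hD : frD m lam * Λ = m * Real.log 2 := by
      rw [frD, ← hΛ]; field_simp
    have : -(Λ * X) * -frD m lam = X * (m * Real.log 2) := by rw [← hD]; ring
    rw [this]
    push_cast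
    have hlog2 : 0 ≤ m * Real.log 2 := by positivity
    nlinarith

/-- Superlevel-set estimate (Lemma on integrability estimates):
`ℒ^d({x ∈ Ω : |x̂|^{−β} (log(e+|x̂|⁻¹))^δ 1_{dist(x̄,𝔠^m) ≤ 4|x̂|} > t})
  ≤ C t^{(𝔇−d)/β} (log t)^{γ𝔇 + (d−𝔇)δ/β}` for `t > 3`. -/
theorem cantor_superlevel_estimate
    {d m k : ℕ} (hd : d = m + k) (hd2 : 2 ≤ d) (hm : 1 ≤ m) (hk : 1 ≤ k)
    {lam gam : ℝ} (hlam0 : 0 < lam) (hlam1 : lam < 1 / 2)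
    (l : ℕ → ℝ) (hl : IsCantorLengths lam gam l)
    (β δ : ℝ) (hβ : 0 < β) :
    ∃ C : ℝ, 0 < C ∧ ∀ t : ℝ, 3 < t →
      volume {x : Euc (m + k) | x ∈ Box (m + k) ∧
          t < ‖hatPart x‖ ^ (-β) * Real.log (Real.exp 1 + ‖hatPart x‖⁻¹) ^ δ *
            (if Metric.infDist (barPart x) (gCantorSetPi l m) ≤ 4 * ‖hatPart x‖
              then 1 else 0)} ≤
        ENNReal.ofReal (C * t ^ ((frD m lam - (d : ℝ)) / β) *
          Real.log t ^ (gam * frD m lam + ((d : ℝ) - frD m lam) * δ / β)) := by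
  obtain ⟨-, hpos, hdec, -⟩ := id hl
  obtain ⟨c, hc, hr⟩ := radius_est β δ hβ
  obtain ⟨K, T, hK, hlev⟩ := choose_level m hlam0 hlam1 l hl β δ hβ
  set A := (frD m lam - (d : ℝ)) / β with hA
  set B := gam * frD m lam + ((d : ℝ) - frD m lam) * δ / β with hB
  -- compact range of `t`
  obtain ⟨q, hq, hqt⟩ : ∃ q : ℝ, 0 < q ∧ ∀ t ∈ Set.Icc 3 (max 3 T), q ≤ t ^ A * Real.log t ^ B := by
    have hpos' : ∀ t ∈ Set.Icc 3 (max 3 T), 0 < t ∧ 0 < Real.log t := fun t ht =>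
      ⟨by linarith [ht.1], Real.log_pos (by linarith [ht.1])⟩
    have hcont : ContinuousOn (fun t : ℝ => t ^ A * Real.log t ^ B) (Set.Icc 3 (max 3 T)) := by
      intro t ht
      obtain ⟨h1, h2⟩ := hpos' t ht
      refine ContinuousAt.continuousWithinAt ?_
      exact (Real.continuousAt_rpow_const _ _ (Or.inl h1.ne')).mul
        ((Real.continuousAt_log h1.ne').rpow_const (Or.inl h2.ne'))
    obtain ⟨t0, ht0, hmin⟩ := isCompact_Icc.exists_isMinOn
      ⟨3, Set.left_mem_Icc.2 (le_max_left 3 T)⟩ hcont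
    obtain ⟨h1, h2⟩ := hpos' t0 ht0
    exact ⟨t0 ^ A * Real.log t0 ^ B, by positivity, fun t ht => hmin ht⟩
  set V := (volume (Box (m + k))).toReal with hV
  have hV0 : 0 ≤ V := ENNReal.toReal_nonneg
  set C2 := (K + 10 * c) ^ m * (2 * c) ^ k with hC2
  have hC20 : 0 < C2 := by positivity
  refine ⟨V / q + C2, by positivity, fun t ht => ?_⟩
  have hL := one_lt_log_of_three_lt ht
  have hL0 : 0 < Real.log t := by linarith
  have ht0 : 0 < t := by linarith
  have hF : 0 < t ^ A * Real.log t ^ B := by positivity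
  have hVq : 0 ≤ V / q := by positivity
  rcases le_total t T with htT | htT
  · calc _ ≤ volume (Box (m + k)) := measure_mono fun x hx => hx.1
      _ = ENNReal.ofReal V := (ENNReal.ofReal_toReal (volume_Box_lt _).ne).symm
      _ ≤ _ := by
        apply ENNReal.ofReal_le_ofReal
        have h1 := hqt t ⟨ht.le, htT.trans (le_max_right _ _)⟩
        have h2 : V = V / q * q := by field_simp
        rw [mul_assoc]
        calc V = V / q * q := h2
          _ ≤ V / q * (t ^ A * Real.log t ^ B) := by gcongr
          _ ≤ _ := by nlinarith
  · obtain ⟨j, hj1, hj2⟩ := hlev t ht htT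
    set R := t ^ (-(1 / β)) * Real.log t ^ (δ / β) with hR
    have hR0 : 0 < R := by positivity
    have hlj := hpos j
    calc _ ≤ volume {x : Euc (m + k) | ‖hatPart x‖ ≤ c * R ∧
            Metric.infDist (barPart x) (gCantorSetPi l m) ≤ 4 * ‖hatPart x‖} := by
          refine measure_mono ?_
          rintro x ⟨-, hx⟩
          split_ifs at hx with hi
          · exact ⟨hr t ht _ (norm_nonneg _) (by simpa using hx), hi⟩
          · simp at hx
            linarith
      _ ≤ _ := geom_est l hpos hdec j (c * R) (by positivity)
      _ ≤ _ := by
        apply ENNReal.ofReal_le_ofReal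
        have hpow : (t ^ (-(1 / β)) * Real.log t ^ (δ / β - gam)) ^ (-frD m lam) * R ^ (m + k)
            = t ^ A * Real.log t ^ B := by
          rw [← Real.rpow_natCast R, hR, Real.mul_rpow (by positivity) (by positivity),
            Real.mul_rpow (by positivity) (by positivity), ← Real.rpow_mul ht0.le,
            ← Real.rpow_mul ht0.le, ← Real.rpow_mul hL0.le, ← Real.rpow_mul hL0.le,
            mul_mul_mul_comm, ← Real.rpow_add ht0, ← Real.rpow_add hL0, hA, hB, hd]
          congr 2
          · field_simp
            ring
          · field_simp
            ring
        calc (2 ^ j * (l j + 10 * (c * R))) ^ m * (2 * (c * R)) ^ k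
            ≤ (2 ^ j * (K * R + 10 * (c * R))) ^ m * (2 * (c * R)) ^ k := by gcongr
          _ = C2 * (2 ^ (j * m) * R ^ (m + k)) := by
            rw [hC2, show K * R + 10 * (c * R) = (K + 10 * c) * R by ring,
              show 2 * (c * R) = (2 * c) * R by ring, mul_pow, mul_pow, mul_pow, pow_add, pow_mul]
            ring
          _ ≤ C2 * ((t ^ (-(1 / β)) * Real.log t ^ (δ / β - gam)) ^ (-frD m lam) *
                R ^ (m + k)) := by gcongr
          _ = C2 * (t ^ A * Real.log t ^ B) := by rw [hpow]
          _ ≤ _ := by nlinarith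
end

section
/- Let d ≥ 2, λ ∈ (0,1/2), γ ∈ ℝ, Ω = (−1,1)^d. Write x = (x̄, x_d) ∈ ℝ^{d−1} × ℝ, let 𝔇 = (d−1) log 2 / log(1/λ), and let b(x) = 1_{{dist(x̄, 𝔠^{d−1}_{λ,γ}) ≤ |x_d|/2}} |x_d|^{𝔇+1−d} (log(e + |x_d|^{−1}))^{−γ𝔇}. Then there is a constant C = C(d,λ,γ) such that for every measurable function f supported in the closure of Ω, ∫_{(−1,1)^{d−1}} I₁^⋈(|f|)(x̄, 0) dμ^{d−1}_{λ,γ}(x̄) ≤ C ∫_Ω |f(y)| b(y) dy. -/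
open MeasureTheory Real Set Metric Filter Topology NNReal ENNReal

section helpers

lemma rc_floor_succ (t : ℝ) (k : ℕ) :
    ⌊t * 2 ^ (k + 1)⌋ = 2 * ⌊t * 2 ^ k⌋ + (if binDigit t k then 1 else 0) := by
  have h1 : ⌊t * 2 ^ (k + 1)⌋ / 2 = ⌊t * 2 ^ k⌋ := by
    have h2 : t * 2 ^ k = t * 2 ^ (k + 1) / ((2 : ℕ) : ℝ) := by
      rw [pow_succ]; push_cast; ring
    rw [h2, Int.floor_div_natCast]; rfl
  unfold binDigit
  by_cases h : ⌊t * 2 ^ (k + 1)⌋ % 2 = 1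
  · simp only [h, decide_true, if_true]; omega
  · simp only [h, decide_false]; simp; omega

/-- Partial sums. -/
noncomputable def rcS (l : ℕ → ℝ) (t : ℝ) (k : ℕ) : ℝ :=
  ∑ j ∈ Finset.range k, if binDigit t j then l j - l (j + 1) else 0

lemma rc_mono {l : ℕ → ℝ} (h2 : ∀ j, 2 * l (j + 1) < l j) {t s : ℝ}
    (ht : t ∈ Ico (0 : ℝ) 1) (hs : s ∈ Ico (0 : ℝ) 1) (k : ℕ) :
    0 ≤ ⌊s * 2 ^ k⌋ - ⌊t * 2 ^ k⌋ →
      ((⌊s * 2 ^ k⌋ - ⌊t * 2 ^ k⌋ : ℤ) : ℝ) * l k ≤ rcS l s k - rcS l t k := by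
  induction k with
  | zero =>
    have h3 : ⌊t⌋ = 0 := Int.floor_eq_zero_iff.2 ht
    have h4 : ⌊s⌋ = 0 := Int.floor_eq_zero_iff.2 hs
    simp [rcS, h3, h4]
  | succ k ih =>
    intro hD
    rw [rc_floor_succ, rc_floor_succ] at hD ⊢
    unfold rcS at ih ⊢
    rw [Finset.sum_range_succ, Finset.sum_range_succ]
    generalize ⌊s * 2 ^ k⌋ = a at *
    generalize ⌊t * 2 ^ k⌋ = b at *
    have hg := h2 k
    have hab : 0 ≤ a - b := by split_ifs at hD <;> omega
    have ih' := ih hab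
    have hab' : (0 : ℝ) ≤ a - b := by exact_mod_cast hab
    push_cast at ih' ⊢
    split_ifs at hD ⊢
    · nlinarith
    · nlinarith
    · have : 1 ≤ a - b := by omega
      have : (1 : ℝ) ≤ a - b := by exact_mod_cast this
      nlinarith
    · nlinarith

lemma rc_anti {l : ℕ → ℝ} (h0 : ∀ j, 0 < l j) (h2 : ∀ j, 2 * l (j + 1) < l j) (j : ℕ) :
    0 ≤ l j - l (j + 1) := by
  linarith [h2 j, h0 (j + 1)]

lemma rc_tail_sum {l : ℕ → ℝ} (h0 : ∀ j, 0 < l j) (h2 : ∀ j, 2 * l (j + 1) < l j) (ε : ℕ → Bool)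
    (k m : ℕ) :
    (∑ j ∈ Finset.range m, if ε (j + k) then l (j + k) - l (j + k + 1) else 0) ≤ l k - l (m + k) := by
  induction m with
  | zero => simp
  | succ m ih =>
    rw [Finset.sum_range_succ]
    have := rc_anti h0 h2 (m + k)
    have e : m + 1 + k = m + k + 1 := by ring
    rw [e]
    split_ifs <;> linarith

lemma rc_nonneg {l : ℕ → ℝ} (h0 : ∀ j, 0 < l j) (h2 : ∀ j, 2 * l (j + 1) < l j) (ε : ℕ → Bool)
    (j : ℕ) : 0 ≤ (if ε j then l j - l (j + 1) else 0) := by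
  have := rc_anti h0 h2 j
  split_ifs <;> linarith

lemma rc_summable {l : ℕ → ℝ} (h0 : ∀ j, 0 < l j) (h2 : ∀ j, 2 * l (j + 1) < l j) (ε : ℕ → Bool) :
    Summable (fun j => if ε j then l j - l (j + 1) else 0) := by
  refine summable_of_sum_range_le (c := l 0) (rc_nonneg h0 h2 ε) fun m => ?_
  have := rc_tail_sum h0 h2 ε 0 m
  simp only [add_zero] at this
  linarith [h0 m]

lemma rc_point_bounds {l : ℕ → ℝ} (h0 : ∀ j, 0 < l j) (h2 : ∀ j, 2 * l (j + 1) < l j) (t : ℝ)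
    (k : ℕ) :
    -(1 / 2 : ℝ) + rcS l t k ≤ gCantorPoint l (binDigit t) ∧
      gCantorPoint l (binDigit t) ≤ -(1 / 2 : ℝ) + rcS l t k + l k := by
  have hs := rc_summable h0 h2 (binDigit t)
  unfold gCantorPoint rcS
  rw [← hs.sum_add_tsum_nat_add k]
  have a : 0 ≤ ∑' j, (if binDigit t (j + k) then l (j + k) - l (j + k + 1) else 0) :=
    tsum_nonneg fun j => rc_nonneg h0 h2 (binDigit t) (j + k)
  have b : ∑' j, (if binDigit t (j + k) then l (j + k) - l (j + k + 1) else 0) ≤ l k := by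
    refine Real.tsum_le_of_sum_range_le (fun j => rc_nonneg h0 h2 (binDigit t) (j + k)) fun m => ?_
    have := rc_tail_sum h0 h2 (binDigit t) k m
    linarith [h0 (m + k)]
  constructor <;> linarith

lemma rc_meas_digit (j : ℕ) : MeasurableSet {t : ℝ | binDigit t j = true} := by
  have : Measurable fun t : ℝ => ⌊t * 2 ^ (j + 1)⌋ := by fun_prop
  have h := this (show MeasurableSet {z : ℤ | z % 2 = 1} from trivial)
  convert h using 1
  ext t; simp [binDigit]

lemma rc_meas {l : ℕ → ℝ} (h0 : ∀ j, 0 < l j) (h2 : ∀ j, 2 * l (j + 1) < l j) :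
    Measurable (fun t => gCantorPoint l (binDigit t)) := by
  have : Measurable (fun t : ℝ => ∑' j : ℕ, if binDigit t j then l j - l (j + 1) else 0) := by
    refine measurable_of_tendsto_metrizable (f := fun k t => rcS l t k) (fun k => ?_)
      (tendsto_pi_nhds.2 fun t => (rc_summable h0 h2 (binDigit t)).hasSum.tendsto_sum_nat)
    unfold rcS
    refine Finset.measurable_sum _ fun j _ => ?_
    exact Measurable.ite (rc_meas_digit j) measurable_const measurable_const
  exact measurable_const.add this

lemma rc_vol {l : ℕ → ℝ} (h0 : ∀ j, 0 < l j) (h2 : ∀ j, 2 * l (j + 1) < l j) (k : ℕ) (a r : ℝ)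
    (hr : 2 * r ≤ l k) :
    volume.restrict (Ico (0 : ℝ) 1) {t | |gCantorPoint l (binDigit t) - a| ≤ r} ≤
      ENNReal.ofReal (3 * (1 / 2) ^ k) := by
  rw [Measure.restrict_apply' measurableSet_Ico]
  refine (Real.volume_le_diam _).trans (Metric.ediam_le fun s hs t ht => ?_)
  wlog hst : t ≤ s generalizing s t
  · rw [edist_comm]; exact this t ht s hs (le_of_not_ge hst)
  rw [edist_dist, Real.dist_eq, abs_of_nonneg (by linarith)]
  apply ENNReal.ofReal_le_ofReal
  by_contra! hc
  obtain ⟨hs1, hs2⟩ := hs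
  obtain ⟨ht1, ht2⟩ := ht
  have hp : (0 : ℝ) < 2 ^ k := by positivity
  have e : ((1 : ℝ) / 2) ^ k * 2 ^ k = 1 := by rw [← mul_pow]; norm_num
  have h3 : t * 2 ^ k + 3 ≤ s * 2 ^ k := by nlinarith
  have h4 : ⌊t * 2 ^ k⌋ + 3 ≤ ⌊s * 2 ^ k⌋ := by
    rw [Int.le_floor]; push_cast; linarith [Int.floor_le (t * 2 ^ k)]
  have h5 := rc_mono h2 ht2 hs2 k (by omega)
  have h6 : (3 : ℝ) ≤ ((⌊s * 2 ^ k⌋ - ⌊t * 2 ^ k⌋ : ℤ) : ℝ) := by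
    have : 3 ≤ ⌊s * 2 ^ k⌋ - ⌊t * 2 ^ k⌋ := by omega
    exact_mod_cast this
  have h7 := rc_point_bounds h0 h2 t k
  have h8 := rc_point_bounds h0 h2 s k
  simp only [mem_ofPred_eq, abs_le] at hs1 ht1
  nlinarith [h0 k]

lemma rc_le_half {l : ℕ → ℝ} (h00 : l 0 = 1) (h2 : ∀ j, 2 * l (j + 1) < l j) (k : ℕ) :
    l k ≤ (1 / 2) ^ k := by
  induction k with
  | zero => simp [h00]
  | succ k ih => rw [pow_succ]; linarith [h2 k]

lemma rc_choose {l : ℕ → ℝ} (h00 : l 0 = 1) (h2 : ∀ j, 2 * l (j + 1) < l j)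
    {ρ : ℝ} (hρ : 0 < ρ) (hρ1 : ρ ≤ 1) : ∃ k, l (k + 1) < ρ ∧ ρ ≤ l k := by
  have hex : ∃ k, l (k + 1) < ρ := by
    obtain ⟨k, hk⟩ := exists_pow_lt_of_lt_one hρ (show (1 / 2 : ℝ) < 1 by norm_num)
    refine ⟨k, (rc_le_half h00 h2 (k + 1)).trans_lt (lt_of_le_of_lt ?_ hk)⟩
    exact pow_le_pow_of_le_one (by norm_num) (by norm_num) (by omega)
  classical
  refine ⟨Nat.find hex, Nat.find_spec hex, ?_⟩
  rcases h : Nat.find hex with _ | m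
  · rw [h00]; exact hρ1
  · exact not_lt.1 (Nat.find_min hex (m := m) (by omega))

lemma rc_rpow_bound {x K g : ℝ} (hK : 1 ≤ K) (h1 : K⁻¹ ≤ x) (h2 : x ≤ K) : x ^ g ≤ K ^ |g| := by
  have hK0 : 0 < K := by linarith
  have hx : 0 < x := (inv_pos.2 hK0).trans_le h1
  rcases le_total 0 g with hg | hg
  · rw [abs_of_nonneg hg]; exact rpow_le_rpow hx.le h2 hg
  · rw [abs_of_nonpos hg, ← inv_inv x, inv_rpow (inv_nonneg.2 hx.le), ← rpow_neg (inv_nonneg.2 hx.le)]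
    refine rpow_le_rpow (inv_nonneg.2 hx.le) ?_ (by linarith)
    rw [inv_le_comm₀ hx hK0]; exact h1

/-- `j` and `log(e+1/ρ)` are comparable. -/
lemma rc_log_compare {lam gam : ℝ} (hlam0 : 0 < lam) (hlam1 : lam < 1 / 2)
    (l : ℕ → ℝ) (hl : IsCantorLengths lam gam l) :
    ∃ K : ℝ, 1 ≤ K ∧ ∀ (ρ : ℝ) (k : ℕ), 0 < ρ → l (k + 1) < ρ → ρ ≤ l k →
      K⁻¹ ≤ ((k + 1 : ℕ) : ℝ) / Real.log (Real.exp 1 + ρ⁻¹) ∧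
      ((k + 1 : ℕ) : ℝ) / Real.log (Real.exp 1 + ρ⁻¹) ≤ K := by
  obtain ⟨h00, h0, h2, -, C, hC1, hC⟩ := hl
  set a : ℝ := Real.log lam⁻¹ + |gam| with ha
  have hloglam : 0 < Real.log lam⁻¹ := Real.log_pos (by
    rw [one_lt_inv₀ hlam0]; linarith)
  have ha0 : 0 < a := by have := abs_nonneg gam; linarith
  have he : 2 < Real.exp 1 := by linarith [Real.exp_one_gt_d9]
  have hlogC : 0 < Real.log (Real.exp 1 + C) := Real.log_pos (by linarith)
  refine ⟨max 3 (Real.log (Real.exp 1 + C) + a), le_max_of_le_left (by norm_num), ?_⟩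
  intro ρ k hρ h1 hk
  set L := Real.log (Real.exp 1 + ρ⁻¹) with hL
  have hρi : 0 < ρ⁻¹ := inv_pos.2 hρ
  have hL1 : 1 ≤ L := by
    rw [hL, Real.le_log_iff_exp_le (by linarith)]; linarith
  have hL0 : 0 < L := by linarith
  constructor
  · -- L ≤ K j
    have hj1 : (1 : ℝ) ≤ ((k + 1 : ℕ) : ℝ) := by push_cast; linarith [(Nat.cast_nonneg k : (0:ℝ) ≤ k)]
    have hLj : L ≤ (Real.log (Real.exp 1 + C) + a) * ((k + 1 : ℕ) : ℝ) := by
      have hlow := (hC (k + 1) (by omega)).1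
      generalize (k + 1) = j at *
      have hjpos : (0 : ℝ) < j := by linarith
      have hjg : Real.exp (-(|gam| * j)) ≤ (j : ℝ) ^ gam := by
        rw [Real.rpow_def_of_pos hjpos]
        apply Real.exp_le_exp.2
        have hlj : Real.log j ≤ j := (Real.log_le_self hjpos.le)
        have hlj0 : 0 ≤ Real.log j := Real.log_nonneg hj1
        nlinarith [neg_abs_le gam, abs_nonneg gam]
      have hlj : Real.exp (-(Real.log lam⁻¹ * j)) = lam ^ j := by
        rw [Real.log_inv, neg_mul, neg_neg, mul_comm, Real.exp_nat_mul, Real.exp_log hlam0]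
      have hlow2 : C⁻¹ * Real.exp (-(a * j)) ≤ ρ := by
        refine le_trans ?_ (hlow.trans h1.le)
        rw [mul_assoc, ← hlj]
        gcongr
        have : -(a * j) = -(Real.log lam⁻¹ * j) + -(|gam| * j) := by rw [ha]; ring
        rw [this, Real.exp_add]
        gcongr
      have hri : ρ⁻¹ ≤ C * Real.exp (a * j) := by
        rw [inv_le_comm₀ hρ (by positivity), mul_inv, ← Real.exp_neg]; exact hlow2
      have hexp1 : 1 ≤ Real.exp (a * j) := Real.one_le_exp (by positivity)
      have : Real.exp 1 + ρ⁻¹ ≤ (Real.exp 1 + C) * Real.exp (a * j) := by nlinarith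
      have := Real.log_le_log (by linarith) this
      rw [Real.log_mul (by linarith) (by positivity), Real.log_exp] at this
      nlinarith
    rw [le_div_iff₀ hL0, inv_mul_le_iff₀ (by positivity)]
    refine hLj.trans ?_
    gcongr
    exact le_max_right _ _
  · refine le_trans ?_ (le_max_left _ _)
    rw [div_le_iff₀ hL0]
    have hpow : (2 : ℝ) ^ k ≤ ρ⁻¹ := by
      rw [le_inv_comm₀ (by positivity) hρ]
      have := hk.trans (rc_le_half h00 h2 k)
      simpa using this
    have : Real.log ((2 : ℝ) ^ k) ≤ L := Real.log_le_log (by positivity) (by linarith)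
    rw [Real.log_pow] at this
    have h69 := Real.log_two_gt_d9
    push_cast
    have hk0 : (0 : ℝ) ≤ k := Nat.cast_nonneg k
    nlinarith

/-- The key scalar estimate. -/
lemma rc_scalar {n : ℕ} (hn : 1 ≤ n) {lam gam : ℝ} (hlam0 : 0 < lam) (hlam1 : lam < 1 / 2)
    (l : ℕ → ℝ) (hl : IsCantorLengths lam gam l) :
    ∃ M : ℝ, 0 < M ∧ ∀ ρ : ℝ, 0 < ρ → ρ ≤ 1 → ∃ k, ρ ≤ l k ∧
      (3 * (1 / 2 : ℝ) ^ k) ^ n ≤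
        M * (ρ ^ frD n lam * Real.log (Real.exp 1 + ρ⁻¹) ^ (-(gam * frD n lam))) := by
  obtain ⟨K, hK1, hK⟩ := rc_log_compare hlam0 hlam1 l hl
  obtain ⟨h00, h0, h2, -, C, hC1, hC⟩ := hl
  have hloglam : 0 < Real.log lam⁻¹ := Real.log_pos (by
    rw [one_lt_inv₀ hlam0]; linarith)
  set D := frD n lam with hD
  have hD0 : 0 ≤ D := by
    rw [hD]; unfold frD
    have := Real.log_pos (show (1 : ℝ) < 2 by norm_num)
    positivity
  have hlamD : lam ^ D = (1 / 2 : ℝ) ^ n := by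
    rw [Real.rpow_def_of_pos hlam0, hD]; unfold frD
    have : Real.log lam * (n * Real.log 2 / Real.log lam⁻¹) = n * (Real.log (1 / 2)) := by
      rw [one_div, Real.log_inv, Real.log_inv] at *
      have : Real.log lam ≠ 0 := by linarith
      field_simp
    rw [this, Real.exp_nat_mul, Real.exp_log (by norm_num)]
  refine ⟨6 ^ n * (C * K ^ |-gam|) ^ D, by positivity, ?_⟩
  intro ρ hρ hρ1
  obtain ⟨k, hk1, hk2⟩ := rc_choose h00 h2 hρ hρ1
  refine ⟨k, hk2, ?_⟩
  obtain ⟨hKa, hKb⟩ := hK ρ k hρ hk1 hk2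
  have he : 2 < Real.exp 1 := by linarith [Real.exp_one_gt_d9]
  set L := Real.log (Real.exp 1 + ρ⁻¹) with hL
  have hL0 : 0 < L := Real.log_pos (by have := inv_pos.2 hρ; linarith)
  have hb := rc_rpow_bound (g := -gam) hK1 hKa hKb
  have hj0 : (0 : ℝ) < ((k + 1 : ℕ) : ℝ) := by positivity
  rw [Real.div_rpow hj0.le hL0.le, div_le_iff₀ (by positivity)] at hb
  have hlow := (hC (k + 1) (by omega)).1.trans hk1.le
  have h6 : lam ^ (k + 1) ≤ C * K ^ |-gam| * (ρ * L ^ (-gam)) := by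
    have h7 : lam ^ (k + 1) ≤ C * ρ * ((k + 1 : ℕ) : ℝ) ^ (-gam) := by
      rw [Real.rpow_neg hj0.le, ← div_eq_mul_inv, le_div_iff₀ (by positivity)]
      rw [mul_assoc, inv_mul_le_iff₀ (by linarith)] at hlow
      exact hlow
    calc _ ≤ _ := h7
      _ ≤ C * ρ * (K ^ |-gam| * L ^ (-gam)) := by gcongr
      _ = _ := by ring
  have h8 := Real.rpow_le_rpow (by positivity) h6 hD0
  have h9 : (lam ^ (k + 1)) ^ D = ((1 / 2 : ℝ) ^ n) ^ (k + 1) := by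
    rw [← hlamD, ← Real.rpow_natCast, ← Real.rpow_natCast, ← Real.rpow_mul hlam0.le,
      ← Real.rpow_mul hlam0.le, mul_comm]
  rw [h9, Real.mul_rpow (by positivity) (by positivity), Real.mul_rpow hρ.le (by positivity),
    ← Real.rpow_mul hL0.le, neg_mul] at h8
  calc (3 * (1 / 2 : ℝ) ^ k) ^ n = 6 ^ n * ((1 / 2 : ℝ) ^ n) ^ (k + 1) := by
        rw [← pow_mul, mul_comm n, pow_mul, ← mul_pow, pow_succ]; congr 1; ring
    _ ≤ 6 ^ n * _ := mul_le_mul_of_nonneg_left h8 (by positivity)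
    _ = _ := by ring

/-- The random point of the Cantor product set. -/
noncomputable def rcX (l : ℕ → ℝ) (n : ℕ) (T : Fin n → ℝ) : Euc n :=
  WithLp.toLp 2 fun i => gCantorPoint l (binDigit (T i))

noncomputable def rcNu (n : ℕ) : Measure (Fin n → ℝ) :=
  Measure.pi fun _ : Fin n => volume.restrict (Ico (0 : ℝ) 1)

instance (n : ℕ) : SFinite (rcNu n) := by unfold rcNu; infer_instance

lemma rcX_meas {l : ℕ → ℝ} (h0 : ∀ j, 0 < l j) (h2 : ∀ j, 2 * l (j + 1) < l j) (n : ℕ) :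
    Measurable (rcX l n) := by
  have h := rc_meas h0 h2
  have : Measurable fun (T : Fin n → ℝ) => fun i => gCantorPoint l (binDigit (T i)) :=
    measurable_pi_lambda _ fun i => h.comp (measurable_pi_apply i)
  exact (MeasurableEquiv.toLp 2 (Fin n → ℝ)).measurable.comp this

lemma rc_measurePi {l : ℕ → ℝ} (h0 : ∀ j, 0 < l j) (h2 : ∀ j, 2 * l (j + 1) < l j) (n : ℕ) :
    gCantorMeasurePi l n = Measure.map (rcX l n) (rcNu n) := by
  have h := rc_meas h0 h2
  unfold gCantorMeasurePi gCantorMeasure rcNu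
  have hfin : IsFiniteMeasure (Measure.map (fun t => gCantorPoint l (binDigit t))
    (volume.restrict (Ico (0 : ℝ) 1))) := inferInstance
  rw [← Measure.pi_map_pi (fun _ => h.aemeasurable), Measure.map_map]
  · rfl
  · exact (MeasurableEquiv.toLp 2 (Fin n → ℝ)).measurable
  · exact measurable_pi_lambda _ fun i => h.comp (measurable_pi_apply i)

lemma rc_nu_ball {l : ℕ → ℝ} (h0 : ∀ j, 0 < l j) (h2 : ∀ j, 2 * l (j + 1) < l j) (n k : ℕ)
    (z : Euc n) (ρ : ℝ) (hρ : ρ ≤ l k) :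
    rcNu n {T | dist z (rcX l n T) ≤ ρ / 2} ≤ ENNReal.ofReal ((3 * (1 / 2 : ℝ) ^ k) ^ n) := by
  have hsub : {T | dist z (rcX l n T) ≤ ρ / 2} ⊆
      Set.univ.pi fun i => {t | |gCantorPoint l (binDigit t) - z i| ≤ ρ / 2} := by
    intro T hT i _
    have h1 : |z i - (rcX l n T) i| ≤ dist z (rcX l n T) := by
      rw [EuclideanSpace.dist_eq]
      refine Real.le_sqrt_of_sq_le ?_
      have h5 := Finset.single_le_sum (f := fun i => dist (z i) ((rcX l n T) i) ^ 2)
        (fun i _ => sq_nonneg _) (Finset.mem_univ i)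
      simpa only [Real.dist_eq] using h5
    have h2 : |z i - (rcX l n T) i| ≤ ρ / 2 := h1.trans hT
    rw [abs_sub_comm] at h2
    exact h2
  refine (measure_mono hsub).trans ?_
  unfold rcNu
  rw [Measure.pi_pi]
  refine (Finset.prod_le_prod' fun i _ => rc_vol h0 h2 k (z i) (ρ / 2) (by linarith)).trans ?_
  rw [Finset.prod_const, Finset.card_univ, Fintype.card_fin, ENNReal.ofReal_pow (by positivity)]

lemma rc_box_convex (n : ℕ) : Convex ℝ (Box n) := by
  intro x hx y hy a b ha hb hab i
  have h1 := abs_lt.1 (hx i)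
  have h2 := abs_lt.1 (hy i)
  show |a * x i + b * y i| < 1
  rw [abs_lt]
  rcases ha.eq_or_lt with rfl | ha
  · have : b = 1 := by linarith
    subst this; constructor <;> linarith
  · constructor <;> nlinarith

lemma rc_box_ae (n : ℕ) : (closure (Box n) : Set (Euc n)) =ᵐ[volume] Box n := by
  have h := (rc_box_convex n).addHaar_frontier (volume : Measure (Euc n))
  refine (ae_eq_set).2 ⟨measure_mono_null ?_ h, measure_mono_null ?_ h⟩
  · intro x hx
    exact ⟨hx.1, fun h => hx.2 (interior_subset h)⟩
  · intro x hx
    exact absurd (subset_closure hx.1) hx.2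

lemma rc_closure_last {n : ℕ} {y : Euc (n + 1)} (hy : y ∈ closure (Box (n + 1))) :
    |lastC y| ≤ 1 := by
  have hc : IsClosed {x : Euc (n + 1) | |lastC x| ≤ 1} := by
    unfold lastC
    exact isClosed_le (by fun_prop) continuous_const
  exact closure_minimal (fun x hx => (hx (Fin.last n)).le) hc hy

lemma rc_lastC_meas (n : ℕ) : Measurable (lastC : Euc (n + 1) → ℝ) := by
  unfold lastC; fun_prop

lemma rc_frontC_meas (n : ℕ) : Measurable (frontC : Euc (n + 1) → Euc n) := by
  have : Measurable fun (x : Euc (n + 1)) => fun i : Fin n => x i.castSucc := by fun_prop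
  exact (MeasurableEquiv.toLp 2 (Fin n → ℝ)).measurable.comp this

lemma rc_inner {n : ℕ} (hn : 1 ≤ n)
    {l : ℕ → ℝ} (h0 : ∀ j, 0 < l j) (h2 : ∀ j, 2 * l (j + 1) < l j) {gD D M : ℝ}
    (hM : 0 < M) (hsc : ∀ ρ : ℝ, 0 < ρ → ρ ≤ 1 → ∃ k, ρ ≤ l k ∧
      (3 * (1 / 2 : ℝ) ^ k) ^ n ≤
        M * (ρ ^ D * Real.log (Real.exp 1 + ρ⁻¹) ^ (-gD)))
    (a : ℝ) (ha : 0 ≤ a) (y : Euc (n + 1)) (hy : |lastC y| ≤ 1) :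
    ∫⁻ T, ENNReal.ofReal ((if dist (frontC y) (rcX l n T) ≤ |lastC y| / 2 then (1 : ℝ) else 0) *
      a * Real.sqrt (dist (frontC y) (rcX l n T) ^ 2 + lastC y ^ 2) ^ (-(n : ℝ))) ∂(rcNu n) ≤
    ENNReal.ofReal M * ENNReal.ofReal (a *
      ((if Metric.infDist (frontC y) (gCantorSetPi l n) ≤ |lastC y| / 2 then (1 : ℝ) else 0) *
        |lastC y| ^ (D + 1 - ((n : ℝ) + 1)) *
        Real.log (Real.exp 1 + |lastC y|⁻¹) ^ (-gD))) := by
  have hn0 : (n : ℝ) ≠ 0 := by positivity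
  set ρ := |lastC y| with hρdef
  set S := {T | dist (frontC y) (rcX l n T) ≤ ρ / 2} with hS
  have hSm : MeasurableSet S :=
    measurableSet_le (measurable_const.dist (rcX_meas h0 h2 n)) measurable_const
  rcases (abs_nonneg (lastC y)).eq_or_lt with hz | hpos
  · have hzero : ∀ T, ENNReal.ofReal
        ((if dist (frontC y) (rcX l n T) ≤ ρ / 2 then (1 : ℝ) else 0) *
        a * Real.sqrt (dist (frontC y) (rcX l n T) ^ 2 + lastC y ^ 2) ^ (-(n : ℝ))) = 0 := by
      intro T
      have hl0 : lastC y = 0 := abs_eq_zero.1 hz.symm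
      split_ifs with h
      · rw [hρdef, hl0, abs_zero, zero_div] at h
        have : dist (frontC y) (rcX l n T) = 0 := le_antisymm h dist_nonneg
        rw [this, hl0]
        simp [Real.zero_rpow (neg_ne_zero.2 hn0)]
      · simp
    simp only [hzero, lintegral_zero]
    exact zero_le
  · rw [← hρdef] at hpos
    have hpt : ∀ T, ENNReal.ofReal
        ((if dist (frontC y) (rcX l n T) ≤ ρ / 2 then (1 : ℝ) else 0) *
        a * Real.sqrt (dist (frontC y) (rcX l n T) ^ 2 + lastC y ^ 2) ^ (-(n : ℝ))) ≤
        S.indicator (fun _ => ENNReal.ofReal (a * ρ ^ (-(n : ℝ)))) T := by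
      intro T
      by_cases h : dist (frontC y) (rcX l n T) ≤ ρ / 2
      · rw [indicator_of_mem (show T ∈ S from h), if_pos h, one_mul]
        apply ENNReal.ofReal_le_ofReal
        refine mul_le_mul_of_nonneg_left ?_ ha
        refine Real.rpow_le_rpow_of_nonpos hpos ?_ (by linarith [(Nat.cast_nonneg n : (0:ℝ) ≤ n)])
        refine Real.le_sqrt_of_sq_le ?_
        rw [hρdef, sq_abs]
        nlinarith [sq_nonneg (dist (frontC y) (rcX l n T))]
      · rw [if_neg h]; simp
    refine (lintegral_mono hpt).trans ?_
    rw [lintegral_indicator_const hSm]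
    rcases S.eq_empty_or_nonempty with hSe | ⟨T, hT⟩
    · rw [hSe]; simp
    · have hmem : rcX l n T ∈ gCantorSetPi l n := fun i => ⟨binDigit (T i), rfl⟩
      have hinf : Metric.infDist (frontC y) (gCantorSetPi l n) ≤ ρ / 2 :=
        (Metric.infDist_le_dist_of_mem hmem).trans hT
      rw [if_pos hinf]
      obtain ⟨k, hk, hk2⟩ := hsc ρ hpos hy
      have hν := (rc_nu_ball h0 h2 n k (frontC y) ρ hk).trans (ENNReal.ofReal_le_ofReal hk2)
      refine (mul_le_mul_right hν _).trans ?_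
      have hnn : 0 ≤ a * ρ ^ (-(n : ℝ)) := by positivity
      rw [← ENNReal.ofReal_mul hnn, ← ENNReal.ofReal_mul hM.le]
      apply ENNReal.ofReal_le_ofReal
      apply le_of_eq
      have : D + 1 - ((n : ℝ) + 1) = -(n : ℝ) + D := by ring
      rw [this, Real.rpow_add hpos]
      ring

end helpers

/-- Restricted Riesz potential bound: integrating `I₁^⋈(|f|)(x̄,0)` against
the Cantor measure `μ^{d−1}_{λ,γ}` is controlled by `∫_Ω |f| b dy`, where
`b = 1_{dist(x̄,𝔠^{d−1}_{λ,γ}) ≤ |x_d|/2} |x_d|^{𝔇+1−d} (log(e+|x_d|⁻¹))^{−γ𝔇}`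
and `𝔇 = (d−1) log 2 / log(1/λ)` (here `d = n+1`). -/
theorem riesz_cantor_estimate
    {n : ℕ} (hn : 1 ≤ n)
    {lam gam : ℝ} (hlam0 : 0 < lam) (hlam1 : lam < 1 / 2)
    (l : ℕ → ℝ) (hl : IsCantorLengths lam gam l)
    (b : Euc (n + 1) → ℝ)
    (hb : ∀ x : Euc (n + 1), b x =
      (if Metric.infDist (frontC x) (gCantorSetPi l n) ≤ |lastC x| / 2 then (1 : ℝ) else 0) *
        |lastC x| ^ (frD n lam + 1 - ((n : ℝ) + 1)) *
        Real.log (Real.exp 1 + |lastC x|⁻¹) ^ (-(gam * frD n lam))) :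
    ∃ C : ℝ, 0 < C ∧ ∀ f : Euc (n + 1) → ℝ, Measurable f →
      (∀ y, y ∉ closure (Box (n + 1)) → f y = 0) →
      (∫⁻ xb in Box n, rieszBow f xb ∂(gCantorMeasurePi l n)) ≤
        ENNReal.ofReal C * ∫⁻ y in Box (n + 1), ENNReal.ofReal (|f y| * b y) := by
  obtain ⟨M, hM, hsc⟩ := rc_scalar hn hlam0 hlam1 l hl
  obtain ⟨h00, h0, h2, -, -⟩ := hl
  refine ⟨M, hM, fun f hf hsupp => ?_⟩
  have hX := rcX_meas h0 h2 n
  have hfr := rc_frontC_meas n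
  have hla := rc_lastC_meas n
  calc ∫⁻ xb in Box n, rieszBow f xb ∂(gCantorMeasurePi l n)
      ≤ ∫⁻ xb, rieszBow f xb ∂(gCantorMeasurePi l n) := setLIntegral_le_lintegral _ _
    _ ≤ ∫⁻ T, rieszBow f (rcX l n T) ∂(rcNu n) := by
        rw [rc_measurePi h0 h2]; exact lintegral_map_le _ _
    _ = ∫⁻ y : Euc (n + 1), ∫⁻ T, ENNReal.ofReal
          ((if dist (frontC y) (rcX l n T) ≤ |lastC y| / 2 then (1 : ℝ) else 0) *
          |f y| * Real.sqrt (dist (frontC y) (rcX l n T) ^ 2 + lastC y ^ 2) ^ (-(n : ℝ)))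
            ∂(rcNu n) := by
        unfold rieszBow
        refine lintegral_lintegral_swap (Measurable.aemeasurable ?_)
        have hd : Measurable fun p : (Fin n → ℝ) × Euc (n + 1) =>
            dist (frontC p.2) (rcX l n p.1) :=
          (hfr.comp measurable_snd).dist (hX.comp measurable_fst)
        have hl2 : Measurable fun p : (Fin n → ℝ) × Euc (n + 1) => lastC p.2 :=
          hla.comp measurable_snd
        have hf2 : Measurable fun p : (Fin n → ℝ) × Euc (n + 1) => |f p.2| :=
          (hf.comp measurable_snd).abs
        refine ENNReal.measurable_ofReal.comp (Measurable.mul (Measurable.mul ?_ hf2) ?_)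
        · exact Measurable.ite (measurableSet_le hd (hl2.abs.div_const 2)) measurable_const
            measurable_const
        · exact (((hd.pow_const 2).add (hl2.pow_const 2)).sqrt).pow_const _
    _ ≤ ∫⁻ y : Euc (n + 1), (closure (Box (n + 1))).indicator
          (fun y => ENNReal.ofReal M * ENNReal.ofReal (|f y| * b y)) y := by
        refine lintegral_mono fun y => ?_
        by_cases hy : y ∈ closure (Box (n + 1))
        · rw [indicator_of_mem hy, hb y]
          exact rc_inner hn h0 h2 hM hsc |f y| (abs_nonneg _) y (rc_closure_last hy)
        · rw [indicator_of_notMem hy]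
          simp [hsupp y hy]
    _ = ∫⁻ y in Box (n + 1), ENNReal.ofReal M * ENNReal.ofReal (|f y| * b y) := by
        rw [lintegral_indicator isClosed_closure.measurableSet,
          Measure.restrict_congr_set (rc_box_ae (n + 1))]
    _ = _ := lintegral_const_mul' _ _ ENNReal.ofReal_ne_top
end

section
/- Let d ≥ 2, 1 < p₀ < d, 𝔇 = d − p₀, λ = 2^{(1−d)/𝔇}, γ ∈ ℝ, and let u and b be the subdimensional competitor and auxiliary function on Ω = (−1,1)^d. Let 1 < p_− ≤ p₀ < p_+ < ∞ and define the variable exponent p(x) = p_− if |x_d| ≤ dist(x̄, 𝔠^{d−1}_{λ,γ}) and p(x) = p_+ otherwise, with φ(x,t) = t^{p(x)}/p(x), F(w) = ∫_Ω φ(x, |∇w(x)|) dx and F*(f) = ∫_Ω φ*(x, |f(x)|) dx, where φ*(x,s) = sup_{t≥0}(st − φ(x,t)) = s^{p'(x)}/p'(x). If p_− < p₀, or p_− = p₀ and γ𝔇 < −1, then F(u) < ∞, F*(b) < ∞, and for every κ > 0 there exist η, s > 0 such that F(η u) + F*(s b) < κ η s. -/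
open MeasureTheory Real Set Metric Filter Topology NNReal ENNReal

lemma cl_le_half {l : ℕ → ℝ} (h0 : l 0 = 1) (h2 : ∀ j, 2 * l (j + 1) < l j) (j : ℕ) :
    l j ≤ (1 / 2 : ℝ) ^ j := by
  induction j with
  | zero => simp [h0]
  | succ k ih => have := h2 k; rw [pow_succ]; linarith

lemma cl_tendsto {l : ℕ → ℝ} (h0 : l 0 = 1) (hpos : ∀ j, 0 < l j)
    (h2 : ∀ j, 2 * l (j + 1) < l j) : Tendsto l atTop (𝓝 0) := by
  refine squeeze_zero (fun j => (hpos j).le) (cl_le_half h0 h2) ?_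
  exact tendsto_pow_atTop_nhds_zero_of_lt_one (by norm_num) (by norm_num)

lemma cl_hasSum_diff {l : ℕ → ℝ} (h0 : l 0 = 1) (hpos : ∀ j, 0 < l j)
    (h2 : ∀ j, 2 * l (j + 1) < l j) (j : ℕ) :
    HasSum (fun i => l (i + j) - l (i + j + 1)) (l j) := by
  rw [hasSum_iff_tendsto_nat_of_nonneg]
  · have : ∀ N, ∑ i ∈ Finset.range N, (l (i + j) - l (i + j + 1)) = l j - l (N + j) := by
      intro N
      induction N with
      | zero => simp
      | succ k ih =>
        rw [Finset.sum_range_succ, ih, show k + 1 + j = k + j + 1 by ring]; ring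
    simp_rw [this]
    have h := ((tendsto_add_atTop_iff_nat j).2 (cl_tendsto h0 hpos h2)).const_sub (l j)
    simpa using h
  · intro i; have := h2 (i + j); have := hpos (i + j + 1); linarith

noncomputable def cPre (l : ℕ → ℝ) (j : ℕ) (ε : Fin j → Bool) : ℝ :=
  -(1 / 2 : ℝ) + ∑ i : Fin j, if ε i then l i - l (i + 1) else 0

lemma cPoint_mem {l : ℕ → ℝ} (h0 : l 0 = 1) (hpos : ∀ j, 0 < l j)
    (h2 : ∀ j, 2 * l (j + 1) < l j) (ε : ℕ → Bool) (j : ℕ) :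
    cPre l j (fun i => ε i) ≤ gCantorPoint l ε ∧
      gCantorPoint l ε ≤ cPre l j (fun i => ε i) + l j := by
  have hn : ∀ i, 0 ≤ l i - l (i + 1) := fun i => by
    have := h2 i; have := hpos (i + 1); linarith
  set f : ℕ → ℝ := fun i => if ε i then l i - l (i + 1) else 0 with hf
  have hf0 : ∀ i, 0 ≤ f i := fun i => by simp only [hf]; split_ifs; exacts [hn i, le_rfl]
  have hfl : ∀ i, f i ≤ l i - l (i + 1) := fun i => by
    simp only [hf]; split_ifs; exacts [le_rfl, hn i]
  have hs : Summable f := by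
    have := (cl_hasSum_diff h0 hpos h2 0).summable
    exact Summable.of_nonneg_of_le hf0 hfl (by simpa using this)
  have hsplit := hs.sum_add_tsum_nat_add j
  have hs' : Summable (fun i => f (i + j)) := (_root_.summable_nat_add_iff j).2 hs
  have t0 : 0 ≤ ∑' i, f (i + j) := tsum_nonneg fun i => hf0 _
  have t1 : ∑' i, f (i + j) ≤ l j := by
    have h := cl_hasSum_diff h0 hpos h2 j
    rw [← h.tsum_eq]
    exact hs'.tsum_le_tsum (fun i => hfl _) h.summable
  have e1 : gCantorPoint l ε = -(1/2) + ∑' i, f i := rfl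
  have e2 : cPre l j (fun i => ε i) = -(1/2) + ∑ i ∈ Finset.range j, f i := by
    rw [cPre, ← Fin.sum_univ_eq_sum_range]
  rw [e1, e2, ← hsplit]
  constructor <;> linarith

lemma cl_comparable {lam gam : ℝ} (hlam : 0 < lam) {l : ℕ → ℝ} (hl : IsCantorLengths lam gam l) :
    ∃ M : ℝ, 0 < M ∧ ∀ j, l j ≤ M * l (j + 1) := by
  obtain ⟨h0, hpos, h2, -, C, hC, hb⟩ := hl
  have hC0 : 0 < C := by linarith
  refine ⟨max (1 / l 1) (C ^ 2 * lam⁻¹ * 2 ^ |gam|), lt_max_of_lt_left (by have := hpos 1; positivity), ?_⟩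
  intro j
  rcases Nat.eq_zero_or_pos j with rfl | hj
  · have h1 := hpos 1
    calc l 0 = 1 / l 1 * l 1 := by rw [h0]; field_simp
      _ ≤ _ := by simp only [zero_add]; gcongr; exact le_max_left _ _
  · have hj0 : (0 : ℝ) < j := by exact_mod_cast hj
    have hj1 : (1 : ℝ) ≤ j := by exact_mod_cast hj
    have hA := (hb j hj).2
    have hB := (hb (j + 1) (by omega)).1
    have key : (j : ℝ) ^ gam ≤ 2 ^ |gam| * ((j + 1 : ℕ) : ℝ) ^ gam := by
      push_cast
      rcases le_total 0 gam with hg | hg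
      · have : (j : ℝ) ^ gam ≤ (j + 1 : ℝ) ^ gam := Real.rpow_le_rpow hj0.le (by linarith) hg
        have h1 : (1 : ℝ) ≤ 2 ^ |gam| := Real.one_le_rpow (by norm_num) (abs_nonneg _)
        have h3 : (0 : ℝ) ≤ (j + 1 : ℝ) ^ gam := by positivity
        nlinarith
      · have h3 : (2 * j : ℝ) ^ gam ≤ (j + 1 : ℝ) ^ gam :=
          Real.rpow_le_rpow_of_nonpos (by linarith) (by linarith) hg
        rw [Real.mul_rpow (by norm_num) hj0.le] at h3
        have h4 : (2 : ℝ) ^ |gam| * 2 ^ gam = 1 := by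
          rw [← Real.rpow_add (by norm_num), abs_of_nonpos hg]; simp
        calc (j : ℝ) ^ gam = 2 ^ |gam| * (2 ^ gam * (j : ℝ) ^ gam) := by
              rw [← mul_assoc, h4, one_mul]
          _ ≤ _ := by gcongr
    calc l j ≤ C * lam ^ j * (j : ℝ) ^ gam := hA
      _ ≤ C * lam ^ j * (2 ^ |gam| * ((j + 1 : ℕ) : ℝ) ^ gam) := by gcongr
      _ = (C ^ 2 * lam⁻¹ * 2 ^ |gam|) * (C⁻¹ * lam ^ (j + 1) * ((j + 1 : ℕ) : ℝ) ^ gam) := by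
          field_simp; ring
      _ ≤ (C ^ 2 * lam⁻¹ * 2 ^ |gam|) * l (j + 1) := by gcongr
      _ ≤ _ := by
        have := hpos (j + 1)
        gcongr; exact le_max_right _ _

lemma cl_summable {n : ℕ} {p₀ gam D lam : ℝ} (hn : 1 ≤ n) (hp₀d : p₀ < (n : ℝ) + 1)
    (hD : D = ((n : ℝ) + 1) - p₀) (hlam : lam = 2 ^ ((1 - ((n : ℝ) + 1)) / D))
    {l : ℕ → ℝ} (hl : IsCantorLengths lam gam l) (r : ℝ)
    (hcase : r < p₀ ∨ (r = p₀ ∧ gam * D < -1)) :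
    Summable (fun j : ℕ => ((2 : ℝ) ^ j) ^ n * (l j) ^ ((n : ℝ) + 1 - r)) := by
  obtain ⟨h0, hpos, h2, -, C, hC, hb⟩ := hl
  have hC0 : 0 < C := by linarith
  have hD0 : 0 < D := by linarith
  have hn0 : (1 : ℝ) ≤ n := by exact_mod_cast hn
  have hlam0 : 0 < lam := by rw [hlam]; positivity
  have hlam1 : lam < 1 := by
    rw [hlam]; apply Real.rpow_lt_one_of_one_lt_of_neg (by norm_num)
    apply div_neg_of_neg_of_pos <;> linarith
  have hlD : (2 : ℝ) ^ n * lam ^ D = 1 := by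
    rw [hlam, ← Real.rpow_mul (by norm_num), ← Real.rpow_natCast, ← Real.rpow_add (by norm_num)]
    rw [div_mul_cancel₀ _ hD0.ne']; simp
  set e : ℝ := (n : ℝ) + 1 - r with he
  have he0 : 0 < e := by rcases hcase with h | h <;> linarith [h]
  set θ : ℝ := lam ^ (p₀ - r) with hθ
  have hθe : (2 : ℝ) ^ n * lam ^ e = θ := by
    rw [show e = D + (p₀ - r) by rw [hD]; ring, Real.rpow_add hlam0, ← mul_assoc, hlD, one_mul]
  have hθ0 : 0 < θ := by positivity
  have bound : ∀ j : ℕ, 1 ≤ j → ((2 : ℝ) ^ j) ^ n * (l j) ^ e ≤ C ^ e * (θ ^ j * (j : ℝ) ^ (gam * e)) := by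
    intro j hj
    have hj0 : (0 : ℝ) < j := by exact_mod_cast hj
    calc ((2 : ℝ) ^ j) ^ n * (l j) ^ e ≤ ((2 : ℝ) ^ j) ^ n * (C * lam ^ j * (j : ℝ) ^ gam) ^ e := by
          gcongr
          · exact (hpos j).le
          · exact (hb j hj).2
      _ = _ := by
          rw [Real.mul_rpow (by positivity) (by positivity), Real.mul_rpow (by positivity) (by positivity),
            ← Real.rpow_mul hj0.le, ← hθe, mul_pow, ← Real.rpow_natCast lam j, ← Real.rpow_mul hlam0.le,
            ← Real.rpow_natCast (lam ^ e) j, ← Real.rpow_mul hlam0.le, mul_comm e, ← pow_mul, ← pow_mul, mul_comm n]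
          ring
  have hS : Summable (fun j : ℕ => C ^ e * (θ ^ j * (j : ℝ) ^ (gam * e))) := by
    apply Summable.mul_left
    rcases hcase with h | ⟨h, hg⟩
    · have hθ1 : θ < 1 := Real.rpow_lt_one hlam0.le hlam1 (by linarith)
      set k := ⌈|gam * e|⌉₊
      have hk := summable_pow_mul_geometric_of_norm_lt_one (R := ℝ) k (r := θ)
        (by rwa [Real.norm_of_nonneg hθ0.le])
      rw [← _root_.summable_nat_add_iff 1] at hk ⊢
      refine Summable.of_nonneg_of_le (fun j => by positivity) (fun j => ?_) hk
      rw [mul_comm]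
      gcongr
      rw [← Real.rpow_natCast]
      apply Real.rpow_le_rpow_of_exponent_le
      · push_cast; linarith [(Nat.cast_nonneg j : (0 : ℝ) ≤ j)]
      · exact (le_abs_self _).trans (Nat.le_ceil _)
    · have : θ = 1 := by rw [hθ, h]; simp
      have he' : e = D := by rw [he, hD, h]
      simp only [this, one_pow, one_mul, he']
      exact Real.summable_nat_rpow.2 hg
  rw [← _root_.summable_nat_add_iff 1] at hS ⊢
  refine Summable.of_nonneg_of_le (fun j => ?_) (fun j => bound (j + 1) (by omega)) hS
  have := hpos (j + 1)
  positivity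

lemma cont_frontC {n : ℕ} : Continuous (frontC : Euc (n + 1) → Euc n) := by
  unfold frontC; fun_prop

lemma cont_lastC {n : ℕ} : Continuous (lastC : Euc (n + 1) → ℝ) := by
  unfold lastC; fun_prop

lemma vol_cube {m : ℕ} (a : Fin m → ℝ) (c : ℝ) :
    volume {x : Euc m | ∀ i, x i ∈ Icc (a i) (a i + c)} = ENNReal.ofReal c ^ m := by
  have h := (PiLp.volume_preserving_ofLp (Fin m)).measure_preimage
    (s := Set.pi univ fun i => Icc (a i) (a i + c))
    (MeasurableSet.univ_pi fun i => measurableSet_Icc).nullMeasurableSet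
  rw [volume_pi_pi] at h
  simp only [Real.volume_Icc, add_sub_cancel_left, Finset.prod_const, Finset.card_univ,
    Fintype.card_fin] at h
  rw [← h]
  congr 1
  ext x
  simp only [mem_setOf_eq, mem_preimage, Set.mem_pi, mem_univ, true_imp_iff]

lemma vol_lastC_zero {n : ℕ} : volume {x : Euc (n + 1) | lastC x = 0} = 0 := by
  have h := (PiLp.volume_preserving_ofLp (Fin (n+1))).measure_preimage
    (s := {y | y (Fin.last n) = 0})
    (measurableSet_eq_fun (measurable_pi_apply _) measurable_const).nullMeasurableSet
  have h2 : volume {y : Fin (n+1) → ℝ | y (Fin.last n) = 0} = 0 :=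
    Measure.pi_hyperplane _ _ _
  rw [h2] at h
  exact h

lemma ae_lastC_ne {n : ℕ} : ∀ᵐ x : Euc (n + 1), lastC x ≠ 0 := by
  rw [ae_iff]; simpa using vol_lastC_zero

def layer {n : ℕ} (l : ℕ → ℝ) (j : ℕ) : Set (Euc (n + 1)) :=
  {x | l (j + 1) < |lastC x| ∧ |lastC x| ≤ l j ∧
    Metric.infDist (frontC x) (gCantorSetPi l n) ≤ 4 * |lastC x|}

lemma measurable_layer {n : ℕ} (l : ℕ → ℝ) (j : ℕ) :
    MeasurableSet (layer l j : Set (Euc (n + 1))) := by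
  have h1 : Measurable fun x : Euc (n + 1) => |lastC x| := cont_lastC.abs.measurable
  have h2 : Measurable fun x : Euc (n + 1) => Metric.infDist (frontC x) (gCantorSetPi l n) :=
    ((Metric.continuous_infDist_pt _).comp cont_frontC).measurable
  refine (measurableSet_lt measurable_const h1).inter
    ((measurableSet_le h1 measurable_const).inter (measurableSet_le h2 (h1.const_mul 4)))

lemma gCantorSetPi_nonempty (l : ℕ → ℝ) (n : ℕ) : (gCantorSetPi l n).Nonempty :=
  ⟨WithLp.toLp 2 fun _ => gCantorPoint l fun _ => false, fun _ => ⟨_, rfl⟩⟩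

lemma vol_layer {n : ℕ} {l : ℕ → ℝ} (h0 : l 0 = 1) (hpos : ∀ j, 0 < l j)
    (h2 : ∀ j, 2 * l (j + 1) < l j) (j : ℕ) :
    volume (layer l j : Set (Euc (n + 1))) ≤
      ENNReal.ofReal (((2 : ℝ) ^ j) ^ n * (11 * l j) ^ (n + 1)) := by
  have hlj := hpos j
  let Q : (Fin n → Fin j → Bool) → Set (Euc (n + 1)) := fun e =>
    {x | ∀ i, x i ∈ Icc ((Fin.snoc (α := fun _ => ℝ) (fun i => cPre l j (e i) - 5 * l j) (-l j) :
        Fin (n + 1) → ℝ) i)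
      ((Fin.snoc (α := fun _ => ℝ) (fun i => cPre l j (e i) - 5 * l j) (-l j) :
        Fin (n + 1) → ℝ) i + 11 * l j)}
  have hsub : (layer l j : Set (Euc (n + 1))) ⊆ ⋃ e, Q e := by
    rintro x ⟨-, hx2, hx3⟩
    have hlt : Metric.infDist (frontC x) (gCantorSetPi l n) < 5 * l j := by linarith
    obtain ⟨y, hy, hxy⟩ := (Metric.infDist_lt_iff (gCantorSetPi_nonempty l n)).1 hlt
    choose ε hε using hy
    refine mem_iUnion.2 ⟨fun i k => ε i k, fun i => ?_⟩
    refine Fin.lastCases ?_ (fun i => ?_) i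
    · simp only [Fin.snoc_last, mem_Icc]
      have := abs_le.1 hx2
      unfold lastC at this
      constructor <;> linarith
    · simp only [Fin.snoc_castSucc, mem_Icc]
      have h3 := cPoint_mem h0 hpos h2 (ε i) j
      rw [hε] at h3
      have h4 : |x i.castSucc - y i| < 5 * l j := by
        refine lt_of_le_of_lt ?_ hxy
        rw [dist_eq_norm]
        exact PiLp.norm_apply_le (frontC x - y) i
      have := abs_lt.1 h4
      constructor <;> linarith
  calc volume (layer l j : Set (Euc (n + 1))) ≤ volume (⋃ e, Q e) := measure_mono hsub
    _ ≤ ∑ e, volume (Q e) := measure_iUnion_fintype_le _ _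
    _ = ∑ e : (Fin n → Fin j → Bool), ENNReal.ofReal (11 * l j) ^ (n + 1) := by
        refine Finset.sum_congr rfl fun e _ => vol_cube _ _
    _ = _ := by
        rw [ENNReal.ofReal_mul (p := ((2 : ℝ) ^ j) ^ n) (by positivity),
          ENNReal.ofReal_pow (p := 11 * l j) (by positivity),
          ENNReal.ofReal_pow (p := (2 : ℝ) ^ j) (by positivity),
          ENNReal.ofReal_pow (p := (2 : ℝ)) (by positivity)]
        simp

lemma main_int {n : ℕ} {l : ℕ → ℝ} (h0 : l 0 = 1) (hpos : ∀ j, 0 < l j)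
    (h2 : ∀ j, 2 * l (j + 1) < l j) {M : ℝ} (hM0 : 0 < M) (hM : ∀ j, l j ≤ M * l (j + 1))
    {r : ℝ} (hr : 0 ≤ r)
    (hS : Summable (fun j : ℕ => ((2 : ℝ) ^ j) ^ n * (l j) ^ ((n : ℝ) + 1 - r))) :
    ∫⁻ x in {x : Euc (n + 1) | x ∈ Box (n + 1) ∧ lastC x ≠ 0 ∧
      Metric.infDist (frontC x) (gCantorSetPi l n) ≤ 4 * |lastC x|},
      ENNReal.ofReal (|lastC x| ^ (-r)) < ⊤ := by
  have hsub : {x : Euc (n + 1) | x ∈ Box (n + 1) ∧ lastC x ≠ 0 ∧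
      Metric.infDist (frontC x) (gCantorSetPi l n) ≤ 4 * |lastC x|} ⊆ ⋃ j, layer l j := by
    rintro x ⟨hx1, hx2, hx3⟩
    have hpos' : 0 < |lastC x| := abs_pos.2 hx2
    have hex : ∃ j, l j < |lastC x| :=
      ((cl_tendsto h0 hpos h2).eventually (gt_mem_nhds hpos')).exists
    classical
    have hf := Nat.find_spec hex
    have hm := fun k => Nat.find_min hex (m := k)
    have hlt1 : |lastC x| < 1 := hx1 _
    obtain ⟨k, hk⟩ : ∃ k, Nat.find hex = k + 1 := by
      apply Nat.exists_eq_succ_of_ne_zero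
      intro h
      rw [h, h0] at hf
      linarith
    refine mem_iUnion.2 ⟨k, ?_, ?_, hx3⟩
    · rwa [hk] at hf
    · exact not_lt.1 (hm k (by omega))
  refine lt_of_le_of_lt (lintegral_mono_set hsub) ?_
  refine lt_of_le_of_lt (lintegral_iUnion_le _ _) ?_
  have hterm : ∀ j, ∫⁻ x in (layer l j : Set (Euc (n + 1))), ENNReal.ofReal (|lastC x| ^ (-r)) ≤
      ENNReal.ofReal ((M ^ r * 11 ^ (n + 1)) *
        (((2 : ℝ) ^ j) ^ n * (l j) ^ ((n : ℝ) + 1 - r))) := by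
    intro j
    have hj := hpos j
    have hj1 := hpos (j + 1)
    have hle : l (j + 1) ^ (-r) ≤ M ^ r * l j ^ (-r) := by
      have h3 : (M * l (j + 1)) ^ (-r) ≤ l j ^ (-r) :=
        Real.rpow_le_rpow_of_nonpos hj (hM j) (by linarith)
      rw [Real.mul_rpow hM0.le hj1.le] at h3
      calc l (j + 1) ^ (-r) = M ^ r * (M ^ (-r) * l (j + 1) ^ (-r)) := by
            rw [← mul_assoc, ← Real.rpow_add hM0]; simp
        _ ≤ _ := by gcongr
    calc ∫⁻ x in (layer l j : Set (Euc (n + 1))), ENNReal.ofReal (|lastC x| ^ (-r))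
        ≤ ∫⁻ x in (layer l j : Set (Euc (n + 1))), ENNReal.ofReal (M ^ r * l j ^ (-r)) := by
          refine setLIntegral_mono' (measurable_layer l j) fun x hx => ?_
          refine ENNReal.ofReal_le_ofReal (le_trans ?_ hle)
          exact Real.rpow_le_rpow_of_nonpos hj1 hx.1.le (by linarith)
      _ = ENNReal.ofReal (M ^ r * l j ^ (-r)) * volume (layer l j : Set (Euc (n + 1))) := by
          rw [setLIntegral_const]
      _ ≤ ENNReal.ofReal (M ^ r * l j ^ (-r)) *
          ENNReal.ofReal (((2 : ℝ) ^ j) ^ n * (11 * l j) ^ (n + 1)) := by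
          gcongr; exact vol_layer h0 hpos h2 j
      _ = _ := by
          rw [← ENNReal.ofReal_mul (by positivity)]
          congr 1
          rw [show (n : ℝ) + 1 - r = -r + ((n + 1 : ℕ) : ℝ) by push_cast; ring,
            Real.rpow_add_natCast hj.ne', mul_pow]
          ring
  refine lt_of_le_of_lt (ENNReal.tsum_le_tsum hterm) ?_
  exact (hS.mul_left _).tsum_ofReal_lt_top

lemma log_bound (c ε : ℝ) (hε : 0 < ε) : ∃ K : ℝ, 0 < K ∧ ∀ t : ℝ, 0 < t → t < 1 →
    Real.log (Real.exp 1 + t⁻¹) ^ c ≤ K * t ^ (-ε) := by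
  set c' : ℝ := |c| + 1
  have hc' : 0 < c' := by positivity
  set δ := ε / c' with hδ
  have hδ0 : 0 < δ := by positivity
  refine ⟨(4 ^ δ / δ) ^ c', by positivity, fun t ht ht1 => ?_⟩
  have hti : 1 ≤ t⁻¹ := (one_le_inv₀ ht).2 ht1.le
  have he : Real.exp 1 < 3 := Real.exp_one_lt_three
  have hL : 1 ≤ Real.log (Real.exp 1 + t⁻¹) := by
    rw [Real.le_log_iff_exp_le (by positivity)]; linarith
  have hL2 : Real.log (Real.exp 1 + t⁻¹) ≤ 4 ^ δ / δ * t ^ (-δ) := by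
    have h1 := Real.log_le_rpow_div (x := Real.exp 1 + t⁻¹) (by positivity) hδ0
    have h2 : (Real.exp 1 + t⁻¹) ^ δ ≤ (4 * t⁻¹) ^ δ := by
      apply Real.rpow_le_rpow (by positivity) _ hδ0.le
      linarith
    rw [Real.mul_rpow (by norm_num) (by positivity), Real.inv_rpow ht.le, ← Real.rpow_neg ht.le] at h2
    calc _ ≤ _ := h1
      _ ≤ _ := div_le_div_of_nonneg_right h2 hδ0.le
      _ = _ := by ring
  calc Real.log (Real.exp 1 + t⁻¹) ^ c ≤ Real.log (Real.exp 1 + t⁻¹) ^ c' :=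
        Real.rpow_le_rpow_of_exponent_le hL (by have := le_abs_self c; simp only [c']; linarith)
    _ ≤ (4 ^ δ / δ * t ^ (-δ)) ^ c' := Real.rpow_le_rpow (by linarith) hL2 hc'.le
    _ = _ := by
      rw [Real.mul_rpow (by positivity) (by positivity), ← Real.rpow_mul ht.le]
      congr 2
      rw [hδ]; field_simp

lemma final_choice {pm pp A B κ : ℝ} (hpm : 1 < pm) (hpp : pm < pp) (hκ : 0 < κ) :
    ∃ η s : ℝ, 0 < η ∧ 0 < s ∧ η ^ pm * A + s ^ (pp / (pp - 1)) * B < κ * η * s := by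
  have h1 : 1 / (pp - 1) < 1 / (pm - 1) := by
    apply one_div_lt_one_div_of_lt <;> linarith
  obtain ⟨a, ha1, ha2⟩ := exists_between h1
  rw [div_lt_iff₀ (by linarith)] at ha1
  rw [lt_div_iff₀ (by linarith)] at ha2
  have hq : pp / (pp - 1) < 1 + a := by
    rw [div_lt_iff₀ (by linarith)]; linarith
  have hT : Tendsto (fun s : ℝ => s ^ (-(1 + a - a * pm)) * A +
      s ^ (-(1 + a - pp / (pp - 1))) * B) atTop (𝓝 (0 * A + 0 * B)) :=
    ((tendsto_rpow_neg_atTop (by linarith)).mul_const A).add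
      ((tendsto_rpow_neg_atTop (by linarith)).mul_const B)
  have hκ' : 0 * A + 0 * B < κ := by simpa using hκ
  obtain ⟨s, hs, hs0⟩ := ((hT.eventually (gt_mem_nhds hκ')).and (eventually_gt_atTop 0)).exists
  refine ⟨s ^ a, s, by positivity, hs0, ?_⟩
  have e : κ * s ^ a * s = κ * s ^ (1 + a) := by rw [Real.rpow_add hs0, Real.rpow_one]; ring
  rw [e, ← Real.rpow_mul hs0.le]
  have := mul_lt_mul_of_pos_right hs (Real.rpow_pos_of_pos hs0 (1 + a))
  refine lt_of_eq_of_lt ?_ this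
  rw [add_mul, mul_right_comm, mul_right_comm _ B, ← Real.rpow_add hs0, ← Real.rpow_add hs0]
  ring_nf

lemma measurable_Box (n : ℕ) : MeasurableSet (Box n) := by
  have : Box n = ⋂ i, {x : Euc n | |x i| < 1} := by ext x; simp [Box]
  rw [this]
  refine MeasurableSet.iInter fun i => ?_
  exact (isOpen_lt (by fun_prop) continuous_const).measurableSet

lemma energy_fin {n : ℕ} {l : ℕ → ℝ} {K r : ℝ} (hK : 0 ≤ K)
    {φ : Euc (n + 1) → ℝ → ℝ} {g : Euc (n + 1) → ℝ}
    (hI : ∫⁻ x in {x : Euc (n + 1) | x ∈ Box (n + 1) ∧ lastC x ≠ 0 ∧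
      Metric.infDist (frontC x) (gCantorSetPi l n) ≤ 4 * |lastC x|},
      ENNReal.ofReal (|lastC x| ^ (-r)) < ⊤)
    (hb : ∀ x ∈ Box (n + 1), lastC x ≠ 0 → φ x (g x) = 0 ∨
      (Metric.infDist (frontC x) (gCantorSetPi l n) ≤ 4 * |lastC x| ∧
        φ x (g x) ≤ K * |lastC x| ^ (-r))) :
    energyOf (Box (n + 1)) φ g < ⊤ := by
  set S := {x : Euc (n + 1) | x ∈ Box (n + 1) ∧ lastC x ≠ 0 ∧
      Metric.infDist (frontC x) (gCantorSetPi l n) ≤ 4 * |lastC x|} with hS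
  set f : Euc (n + 1) → ℝ≥0∞ := fun x => ENNReal.ofReal (|lastC x| ^ (-r)) with hf
  have h1 : energyOf (Box (n + 1)) φ g ≤
      ∫⁻ x in Box (n + 1), ENNReal.ofReal K * S.indicator f x := by
    refine lintegral_mono_ae ((ae_restrict_iff' (measurable_Box _)).2
      (ae_lastC_ne.mono fun x hx hxB => ?_))
    rcases hb x hxB hx with h | ⟨h3, h4⟩
    · simp [h]
    · rw [Set.indicator_of_mem (show x ∈ S from ⟨hxB, hx, h3⟩), hf, ← ENNReal.ofReal_mul hK]
      exact ENNReal.ofReal_le_ofReal h4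
  refine lt_of_le_of_lt h1 ?_
  rw [lintegral_const_mul' _ _ ENNReal.ofReal_ne_top]
  refine ENNReal.mul_lt_top ENNReal.ofReal_lt_top ?_
  calc ∫⁻ x in Box (n + 1), S.indicator f x ≤ ∫⁻ x, S.indicator f x := setLIntegral_le_lintegral _ _
    _ ≤ ∫⁻ x in S, f x := lintegral_indicator_le _ _
    _ < ⊤ := hI

lemma grad_bound {n : ℕ} (ρ : Euc (n + 1) → ℝ) (l : ℕ → ℝ)
    (hρ3 : ∃ C : ℝ, 0 < C ∧ ∀ x : Euc (n + 1),
      ¬(frontC x ∈ gCantorSetPi l n ∧ lastC x = 0) →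
      ‖fderiv ℝ ρ x‖ ≤ C * |lastC x|⁻¹ *
        (if 2 * |lastC x| ≤ Metric.infDist (frontC x) (gCantorSetPi l n) ∧
            Metric.infDist (frontC x) (gCantorSetPi l n) ≤ 4 * |lastC x| then 1 else 0))
    (u : Euc (n + 1) → ℝ) (hu : ∀ x, u x = (1 / 2) * Real.sign (lastC x) * ρ x) :
    ∃ C : ℝ, 0 < C ∧ ∀ x : Euc (n + 1), lastC x ≠ 0 →
      ‖fderiv ℝ u x‖ ≤ C * |lastC x|⁻¹ *
        (if 2 * |lastC x| ≤ Metric.infDist (frontC x) (gCantorSetPi l n) ∧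
            Metric.infDist (frontC x) (gCantorSetPi l n) ≤ 4 * |lastC x| then 1 else 0) := by
  obtain ⟨C, hC, h⟩ := hρ3
  refine ⟨C, hC, fun x hx => le_trans ?_ (h x fun hh => hx hh.2)⟩
  have key : ∃ c : ℝ, |c| ≤ 1 ∧ u =ᶠ[𝓝 x] c • ρ := by
    rcases lt_or_gt_of_ne hx with hx | hx
    · refine ⟨-(1/2), by norm_num [abs_of_pos], ?_⟩
      filter_upwards [(isOpen_lt cont_lastC continuous_const).mem_nhds hx] with y hy
      rw [hu, Real.sign_of_neg hy]; simp
    · refine ⟨1/2, by norm_num [abs_of_pos], ?_⟩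
      filter_upwards [(isOpen_lt continuous_const cont_lastC).mem_nhds hx] with y hy
      rw [hu, Real.sign_of_pos hy]; simp
  obtain ⟨c, hc, he⟩ := key
  rw [he.fderiv_eq, fderiv_const_smul_field, Pi.smul_apply, norm_smul, Real.norm_eq_abs]
  nlinarith [norm_nonneg (fderiv ℝ ρ x)]

/-- The piecewise-constant variable exponent model satisfies the main
assumption: with `p(x) = p_−` for `|x_d| ≤ dist(x̄,𝔠^{d−1}_{λ,γ})` and `p(x) = p_+`
otherwise, `φ(x,t) = t^{p(x)}/p(x)`, `φ*(x,s) = s^{p'(x)}/p'(x)`, if `p_− < p₀`, or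
`p_− = p₀` and `γ𝔇 < −1`, then `F(u) < ∞`, `F*(b) < ∞`, and for every `κ > 0` there are
`η, s > 0` with `F(η u) + F*(s b) < κ η s` (here `d = n+1`, `𝔇 = d − p₀`,
`λ = 2^{(1−d)/𝔇}`). -/
theorem varexp_main_assumption
    {n : ℕ} (hn : 1 ≤ n) (p₀ gam D lam : ℝ) (hp₀ : 1 < p₀) (hp₀d : p₀ < (n : ℝ) + 1)
    (hD : D = ((n : ℝ) + 1) - p₀) (hlam : lam = 2 ^ ((1 - ((n : ℝ) + 1)) / D))
    (l : ℕ → ℝ) (hl : IsCantorLengths lam gam l)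
    (ρ : Euc (n + 1) → ℝ)
    (hρsmooth : ContDiffOn ℝ (⊤ : ℕ∞) ρ
      {x : Euc (n + 1) | frontC x ∈ gCantorSetPi l n ∧ lastC x = 0}ᶜ)
    (hρ1 : ∀ x : Euc (n + 1),
      (if Metric.infDist (frontC x) (gCantorSetPi l n) ≤ 2 * |lastC x| then (1 : ℝ) else 0)
        ≤ ρ x)
    (hρ2 : ∀ x : Euc (n + 1),
      ρ x ≤ if Metric.infDist (frontC x) (gCantorSetPi l n) ≤ 4 * |lastC x| then 1 else 0)
    (hρ3 : ∃ C : ℝ, 0 < C ∧ ∀ x : Euc (n + 1),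
      ¬(frontC x ∈ gCantorSetPi l n ∧ lastC x = 0) →
      ‖fderiv ℝ ρ x‖ ≤ C * |lastC x|⁻¹ *
        (if 2 * |lastC x| ≤ Metric.infDist (frontC x) (gCantorSetPi l n) ∧
            Metric.infDist (frontC x) (gCantorSetPi l n) ≤ 4 * |lastC x| then 1 else 0))
    (u : Euc (n + 1) → ℝ) (hu : ∀ x, u x = (1 / 2) * Real.sign (lastC x) * ρ x)
    (b : Euc (n + 1) → ℝ)
    (hb : ∀ x : Euc (n + 1), b x =
      (if Metric.infDist (frontC x) (gCantorSetPi l n) ≤ |lastC x| / 2 then (1 : ℝ) else 0) *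
        |lastC x| ^ (D + 1 - ((n : ℝ) + 1)) *
        Real.log (Real.exp 1 + |lastC x|⁻¹) ^ (-(gam * D)))
    (pm pp : ℝ) (hpm : 1 < pm) (hpmp₀ : pm ≤ p₀) (hppp₀ : p₀ < pp)
    (p : Euc (n + 1) → ℝ)
    (hp : ∀ x : Euc (n + 1), p x =
      if |lastC x| ≤ Metric.infDist (frontC x) (gCantorSetPi l n) then pm else pp)
    (hcase : pm < p₀ ∨ (pm = p₀ ∧ gam * D < -1)) :
    energyOf (Box (n + 1)) (fun x t => t ^ p x / p x) (fun x => ‖fderiv ℝ u x‖) < ⊤ ∧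
    energyOf (Box (n + 1)) (fun x t => t ^ (p x / (p x - 1)) / (p x / (p x - 1)))
      (fun x => |b x|) < ⊤ ∧
    ∀ κ : ℝ, 0 < κ → ∃ η s : ℝ, 0 < η ∧ 0 < s ∧
      energyOf (Box (n + 1)) (fun x t => t ^ p x / p x) (fun x => η * ‖fderiv ℝ u x‖) +
        energyOf (Box (n + 1)) (fun x t => t ^ (p x / (p x - 1)) / (p x / (p x - 1)))
          (fun x => s * |b x|) < ENNReal.ofReal (κ * η * s) := by
  obtain ⟨h0, hpos, h2, -⟩ := id hl
  have hlam0 : 0 < lam := by rw [hlam]; positivity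
  obtain ⟨M, hM0, hM⟩ := cl_comparable hlam0 hl
  have hD0 : 0 < D := by linarith
  have hpp1 : 1 < pp := by linarith
  set q : ℝ := pp / (pp - 1) with hq
  have hq0 : 0 < q := div_pos (by linarith) (by linarith)
  obtain ⟨C, hC0, hgrad⟩ := grad_bound ρ l hρ3 u hu
  have hSm := cl_summable hn hp₀d hD hlam hl pm hcase
  -- gradient lives where `p = pm`
  have hgp : ∀ x : Euc (n + 1), lastC x ≠ 0 → ‖fderiv ℝ u x‖ ≠ 0 → p x = pm := by
    intro x hx hne
    have hx0 := abs_pos.2 hx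
    have h := hgrad x hx
    rw [hp, if_pos]
    split_ifs at h with h3
    · linarith [h3.1]
    · exact absurd (le_antisymm (by simpa using h) (norm_nonneg _)) hne
  have hbp : ∀ x : Euc (n + 1), lastC x ≠ 0 → |b x| ≠ 0 → p x = pp := by
    intro x hx hne
    have hx0 := abs_pos.2 hx
    rw [hp, if_neg]
    intro hle
    apply hne
    rw [hb, if_neg (by intro h; linarith)]
    simp
  have hp0 : ∀ x, 0 < p x := fun x => by rw [hp]; split_ifs <;> linarith
  have hp1 : ∀ x, 1 < p x := fun x => by rw [hp]; split_ifs <;> linarith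
  have hp'0 : ∀ x, 0 < p x / (p x - 1) := fun x =>
    div_pos (hp0 x) (by linarith [hp1 x])
  have hA : energyOf (Box (n + 1)) (fun x t => t ^ p x / p x) (fun x => ‖fderiv ℝ u x‖) < ⊤ := by
    refine energy_fin (l := l) (K := C ^ pm / pm) (r := pm) (by positivity)
      (main_int h0 hpos h2 hM0 hM (by linarith) hSm) ?_
    intro x hx hx0
    have ht := abs_pos.2 hx0
    by_cases hz : ‖fderiv ℝ u x‖ = 0
    · left
      simp [hz, Real.zero_rpow (hp0 x).ne']
    · right
      have h := hgrad x hx0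
      split_ifs at h with h3
      · refine ⟨h3.2, ?_⟩
        rw [hgp x hx0 hz]
        rw [mul_one] at h
        calc ‖fderiv ℝ u x‖ ^ pm / pm ≤ (C * |lastC x|⁻¹) ^ pm / pm := by gcongr
          _ = _ := by
            rw [Real.mul_rpow hC0.le (by positivity), Real.inv_rpow ht.le, Real.rpow_neg ht.le]
            ring
      · exact absurd (le_antisymm (by simpa using h) (norm_nonneg _)) hz
  have hB : energyOf (Box (n + 1)) (fun x t => t ^ (p x / (p x - 1)) / (p x / (p x - 1)))
      (fun x => |b x|) < ⊤ := by
    have hlt : p₀ - 1 < p₀ / q := by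
      rw [hq, lt_div_iff₀ (by positivity), mul_div_assoc', div_lt_iff₀ (by linarith)]
      nlinarith
    obtain ⟨e, he1, he2⟩ := exists_between hlt
    obtain ⟨K, hK0, hK⟩ := log_bound (-(gam * D)) (e - (p₀ - 1)) (by linarith)
    have hr : e * q < p₀ := by rwa [lt_div_iff₀ hq0] at he2
    have hSr := cl_summable hn hp₀d hD hlam hl (e * q) (Or.inl hr)
    have he0 : 0 < e := by linarith
    refine energy_fin (l := l) (K := K ^ q / q) (r := e * q) (by positivity)
      (main_int h0 hpos h2 hM0 hM (by positivity) hSr) ?_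
    intro x hx hx0
    have ht := abs_pos.2 hx0
    have ht1 : |lastC x| < 1 := hx _
    by_cases hz : |b x| = 0
    · left
      simp only [hz]
      rw [Real.zero_rpow (hp'0 x).ne', zero_div]
    · right
      have hd : Metric.infDist (frontC x) (gCantorSetPi l n) ≤ |lastC x| / 2 := by
        by_contra hcon
        apply hz
        rw [hb, if_neg hcon]; simp
      refine ⟨by linarith, ?_⟩
      rw [hbp x hx0 hz]
      have hlog : 0 ≤ Real.log (Real.exp 1 + |lastC x|⁻¹) := by
        apply Real.log_nonneg
        have := Real.add_one_le_exp 1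
        have : 0 < |lastC x|⁻¹ := by positivity
        linarith
      have hbb : |b x| ≤ K * |lastC x| ^ (-e) := by
        rw [hb, if_pos hd, one_mul, abs_of_nonneg (by positivity)]
        calc _ ≤ |lastC x| ^ (D + 1 - ((n : ℝ) + 1)) * (K * |lastC x| ^ (-(e - (p₀ - 1)))) := by
              gcongr; exact hK _ ht ht1
          _ = _ := by
              rw [mul_left_comm, ← Real.rpow_add ht]
              congr 2
              rw [hD]; ring
      calc |b x| ^ (pp / (pp - 1)) / (pp / (pp - 1)) ≤ (K * |lastC x| ^ (-e)) ^ q / q := by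
            rw [← hq]; gcongr
        _ = _ := by
            rw [Real.mul_rpow hK0.le (by positivity), ← Real.rpow_mul ht.le]
            ring_nf
  refine ⟨hA, hB, fun κ hκ => ?_⟩
  obtain ⟨η, s, hη, hs, hlt⟩ := final_choice (A := (energyOf (Box (n + 1))
    (fun x t => t ^ p x / p x) (fun x => ‖fderiv ℝ u x‖)).toReal)
    (B := (energyOf (Box (n + 1)) (fun x t => t ^ (p x / (p x - 1)) / (p x / (p x - 1)))
      (fun x => |b x|)).toReal) hpm (show pm < pp by linarith) hκ
  refine ⟨η, s, hη, hs, ?_⟩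
  have e1 : energyOf (Box (n + 1)) (fun x t => t ^ p x / p x) (fun x => η * ‖fderiv ℝ u x‖) =
      ENNReal.ofReal (η ^ pm) * energyOf (Box (n + 1)) (fun x t => t ^ p x / p x)
        (fun x => ‖fderiv ℝ u x‖) := by
    unfold energyOf
    rw [← lintegral_const_mul' _ _ ENNReal.ofReal_ne_top]
    refine lintegral_congr_ae (ae_restrict_of_ae (ae_lastC_ne.mono fun x hx => ?_))
    simp only
    rw [← ENNReal.ofReal_mul (by positivity)]
    congr 1
    by_cases hz : ‖fderiv ℝ u x‖ = 0
    · simp [hz, Real.zero_rpow (hp0 x).ne']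
    · rw [hgp x hx hz, Real.mul_rpow hη.le (norm_nonneg _), mul_div_assoc]
  have e2 : energyOf (Box (n + 1)) (fun x t => t ^ (p x / (p x - 1)) / (p x / (p x - 1)))
        (fun x => s * |b x|) =
      ENNReal.ofReal (s ^ q) * energyOf (Box (n + 1))
        (fun x t => t ^ (p x / (p x - 1)) / (p x / (p x - 1))) (fun x => |b x|) := by
    unfold energyOf
    rw [← lintegral_const_mul' _ _ ENNReal.ofReal_ne_top]
    refine lintegral_congr_ae (ae_restrict_of_ae (ae_lastC_ne.mono fun x hx => ?_))
    simp only
    rw [← ENNReal.ofReal_mul (by positivity)]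
    congr 1
    by_cases hz : |b x| = 0
    · rw [hz, mul_zero, Real.zero_rpow (hp'0 x).ne']; simp
    · rw [hbp x hx hz, Real.mul_rpow hs.le (abs_nonneg _), mul_div_assoc]
  rw [e1, e2]
  rw [← ENNReal.ofReal_toReal hA.ne, ← ENNReal.ofReal_toReal hB.ne,
    ← ENNReal.ofReal_mul (by positivity), ← ENNReal.ofReal_mul (by positivity),
    ← ENNReal.ofReal_add (by positivity) (by positivity)]
  exact (ENNReal.ofReal_lt_ofReal_iff (by positivity)).2 hlt
end
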